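/- Let φ : [0,∞) → [0,∞) satisfy φ(t) = o(t^{1/3}) as t → ∞. If 𝒞 is a flexible class of rank-one systems, then there exists a rank-one system T belonging to 𝒞 which is φ-integrably orbit equivalent to the universal odometer. -/

import Mathlib

/-- A measure-theoretic dynamical system: an invertible bimeasurable transformation
of a measure space. -/
structure MSystem where
  carrier : Type
  [meas : MeasurableSpace carrier]
  μ : MeasureTheory.Measure carrier
  T : carrier ≃ᵐ carrier

attribute [instance] MSystem.meas

open MeasureTheory Filter Set Topology

/-- A cutting and spacing parameter: an integer `q ≥ 2` (the cutting parameter) together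
with nonnegative integers `σ 0, …, σ q` (the spacing parameters), represented as a
function `ℕ → ℕ` vanishing above `q`. -/
structure CSParam where
  q : ℕ
  two_le_q : 2 ≤ q
  σ : ℕ → ℕ
  σ_eq_zero_of_gt : ∀ i, q < i → σ i = 0

/-- The total number `σ_n = σ_{n,0} + ⋯ + σ_{n,q_n}` of spacers added at one step. -/
def CSParam.σtot (P : CSParam) : ℕ := ∑ i ∈ Finset.range (P.q + 1), P.σ i

/-- The height sequence associated with a sequence of cutting and spacing parameters:
`h 0 = 1` and `h (n+1) = q_n · h_n + σ_n`. -/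
def heights (p : ℕ → CSParam) : ℕ → ℕ
  | 0 => 1
  | n + 1 => (p n).q * heights p n + (p n).σtot

/-- `Z_n`, the maximum spacing parameter over the first `n+1` steps. -/
def Zmax (p : ℕ → CSParam) (n : ℕ) : ℕ :=
  (Finset.range (n + 1)).sup fun j => (Finset.range ((p j).q + 1)).sup (p j).σ

/-- Condition (F): the series `Σ σ_n / h_{n+1}` converges. -/
def CondF (p : ℕ → CSParam) : Prop :=
  Summable fun n => ((p n).σtot : ℝ) / (heights p (n + 1) : ℝ)

/-- The level of the `(n+1)`-th tower at which the `i`-th subcolumn of the `n`-th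
tower starts, namely `σ_{n,0} + ⋯ + σ_{n,i} + i·h_n`. -/
def colStart (p : ℕ → CSParam) (n i : ℕ) : ℕ :=
  (∑ j ∈ Finset.range (i + 1), (p n).σ j) + i * heights p n

/-- The subset `X_n` covered by the `n`-th tower. -/
def towerUnion {X : Type} [MeasurableSpace X] (T : X ≃ᵐ X) (p : ℕ → CSParam)
    (B : ℕ → Set X) (n : ℕ) : Set X :=
  ⋃ k ∈ Finset.range (heights p n), (⇑T)^[k] '' B n

/-- A cutting-and-stacking tower structure for `T`, with parameters `p`, bases `B n`
(so that the `n`-th tower has levels `T^k (B n)`, `k < h_n`), and subdivision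
`Bsub n 0, …, Bsub n (q_n - 1)` of `B n`: the `(n+1)`-th tower is obtained by stacking,
in order, `σ_{n,0}` spacer levels, the subcolumn over `Bsub n 0`, `σ_{n,1}` spacer levels,
…, the subcolumn over `Bsub n (q_n-1)`, and `σ_{n,q_n}` spacer levels on top, the spacer
levels being disjoint from `X_n`. -/
structure IsCuttingStacking {X : Type} [MeasurableSpace X] (T : X ≃ᵐ X)
    (p : ℕ → CSParam) (B : ℕ → Set X) (Bsub : ℕ → ℕ → Set X) : Prop where
  meas_base : ∀ n, MeasurableSet (B n)
  meas_sub : ∀ n, ∀ i < (p n).q, MeasurableSet (Bsub n i)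
  disj_levels : ∀ n, ∀ k < heights p n, ∀ l < heights p n, k ≠ l →
    Disjoint ((⇑T)^[k] '' B n) ((⇑T)^[l] '' B n)
  disj_sub : ∀ n, ∀ i < (p n).q, ∀ j < (p n).q, i ≠ j → Disjoint (Bsub n i) (Bsub n j)
  union_sub : ∀ n, B n = ⋃ i ∈ Finset.range (p n).q, Bsub n i
  subcolumn : ∀ n, ∀ i < (p n).q, ∀ k < heights p n,
    (⇑T)^[colStart p n i + k] '' B (n + 1) = (⇑T)^[k] '' Bsub n i
  spacer_disjoint : ∀ n, ∀ l < heights p (n + 1),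
    (∀ i < (p n).q, ∀ k < heights p n, l ≠ colStart p n i + k) →
    Disjoint ((⇑T)^[l] '' B (n + 1)) (towerUnion T p B n)

/-- The towers with bases `B n` increase to the full σ-algebra modulo `μ`-null sets. -/
def TowersGenerate {X : Type} [MeasurableSpace X] (μ : Measure X) (T : X ≃ᵐ X)
    (p : ℕ → CSParam) (B : ℕ → Set X) : Prop :=
  ∀ A : Set X, MeasurableSet A → ∃ A' : Set X,
    MeasurableSet[MeasurableSpace.generateFrom
      {s : Set X | ∃ n k, k < heights p n ∧ s = (⇑T)^[k] '' B n}] A' ∧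
    μ (symmDiff A A') = 0

/-- `T` is a rank-one system with cutting and spacing parameters `p` on `(X, μ)`. -/
def IsRankOneWith {X : Type} [MeasurableSpace X] (μ : Measure X) (T : X ≃ᵐ X)
    (p : ℕ → CSParam) : Prop :=
  MeasurePreserving T μ μ ∧ CondF p ∧
    ∃ B Bsub, IsCuttingStacking T p B Bsub ∧ TowersGenerate μ T p B

/-- `T` is a rank-one system on `(X, μ)`. -/
def IsRankOne {X : Type} [MeasurableSpace X] (μ : Measure X) (T : X ≃ᵐ X) : Prop :=
  ∃ p, IsRankOneWith μ T p

/-- Iterates, indexed by `ℤ`, of a measurable equivalence. -/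
def zIter {X : Type} [MeasurableSpace X] (T : X ≃ᵐ X) (n : ℤ) (x : X) : X :=
  if 0 ≤ n then (⇑T)^[n.toNat] x else (⇑T.symm)^[(-n).toNat] x

/-- The `T`-orbit of a point. -/
def orbit {X : Type} [MeasurableSpace X] (T : X ≃ᵐ X) (x : X) : Set X :=
  Set.range fun n : ℤ => zIter T n x

/-- `S` is the universal odometer: a rank-one system admitting a construction with no
spacers whose cutting parameters `q'_n` are such that every positive integer divides
some product `q'_0 ⋯ q'_{n-1}`. -/
def IsUniversalOdometer {X : Type} [MeasurableSpace X] (μ : Measure X) (S : X ≃ᵐ X) : Prop :=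
  ∃ p : ℕ → CSParam, IsRankOneWith μ S p ∧ (∀ n i, (p n).σ i = 0) ∧
    ∀ N : ℕ, 0 < N → ∃ n, N ∣ ∏ k ∈ Finset.range n, (p k).q

/-- `T` (acting on `(X,μ)`) and `S` (acting on `(Y,ν)`) are φ-integrably orbit
equivalent: there is a measure-preserving bimeasurable bijection matching a.e. `T`-orbit
with the corresponding `S`-orbit, whose cocycles `c_T`, `c_S` satisfy
`∫ φ(|c_T|) dμ < ∞` and `∫ φ(|c_S|) dν < ∞`. -/
def PhiIntegrablyOE {X Y : Type} [MeasurableSpace X] [MeasurableSpace Y]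
    (μ : Measure X) (T : X ≃ᵐ X) (ν : Measure Y) (S : Y ≃ᵐ Y) (φ : ℝ → ℝ) : Prop :=
  ∃ Ψ : X ≃ᵐ Y, MeasurePreserving Ψ μ ν ∧
    (∀ᵐ x ∂μ, Ψ '' orbit T x = orbit S (Ψ x)) ∧
    ∃ cT : X → ℤ, ∃ cS : Y → ℤ,
      Measurable cT ∧ Measurable cS ∧
      (∀ᵐ x ∂μ, Ψ (T x) = zIter S (cT x) (Ψ x)) ∧
      (∀ᵐ y ∂ν, Ψ.symm (S y) = zIter T (cS y) (Ψ.symm y)) ∧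
      Integrable (fun x => φ |(cT x : ℝ)|) μ ∧
      Integrable (fun y => φ |(cS y : ℝ)|) ν

/-- The underlying space is a standard atomless probability space. -/
def MSystem.Standard (𝒮 : MSystem) : Prop :=
  StandardBorelSpace 𝒮.carrier ∧ IsProbabilityMeasure 𝒮.μ ∧ NoAtoms 𝒮.μ

/-- `T` is φ-integrably orbit equivalent to the universal odometer. -/
def PhiOEToUnivOdometer {X : Type} [MeasurableSpace X] (μ : Measure X) (T : X ≃ᵐ X)
    (φ : ℝ → ℝ) : Prop :=
  ∃ 𝒮 : MSystem, 𝒮.Standard ∧ IsUniversalOdometer 𝒮.μ 𝒮.T ∧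
    PhiIntegrablyOE μ T 𝒮.μ 𝒮.T φ

/-- `φ(t) = o(t^{1/3})` as `t → ∞`. -/
def SmallOCbrt (φ : ℝ → ℝ) : Prop :=
  Tendsto (fun t : ℝ => φ t / t ^ ((1 : ℝ) / 3)) atTop (nhds 0)

/-- The height reached after applying a finite list of cutting and spacing parameters
(`h_n` for a list of length `n`). -/
def listHeight (L : List CSParam) : ℕ := L.foldl (fun h P => P.q * h + P.σtot) 1

/-- A class `𝒞` of systems is flexible: there is a set `F` of finite sequences of
cutting and spacing parameters such that (1) for some constant `C > 0`, every infinite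
parameter sequence satisfying condition (F) all of whose initial segments lie in `F`
satisfies `Z_n ≤ C·h_n` for all `n`, and every rank-one system admitting a
cutting-and-stacking construction with these parameters belongs to `𝒞`; (2) `F`
contains a length-one sequence with cutting parameter `≥ 3`; and (3) for some constant
`C' > 0`, every nonempty sequence of `F` (say of length `n`) can be extended inside `F`
by infinitely many choices of cutting parameter `q_n`, with spacing parameters
satisfying `σ_n ≤ C'·q_n·h_{n-1}`. -/
def IsFlexibleClass (𝒞 : MSystem → Prop) : Prop :=
  ∃ F : Set (List CSParam),
    (∃ C : ℝ, 0 < C ∧ ∀ p : ℕ → CSParam, CondF p →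
      (∀ n : ℕ, (List.ofFn fun k : Fin (n + 1) => p k.val) ∈ F) →
      (∀ n, (Zmax p n : ℝ) ≤ C * (heights p n : ℝ)) ∧
      ∀ 𝒮 : MSystem, 𝒮.Standard → IsRankOneWith 𝒮.μ 𝒮.T p → 𝒞 𝒮) ∧
    (∃ P : CSParam, [P] ∈ F ∧ 3 ≤ P.q) ∧
    (∃ C' : ℝ, 0 < C' ∧ ∀ L : List CSParam, L ∈ F → L ≠ [] →
      {q : ℕ | ∃ P : CSParam, P.q = q ∧
        (P.σtot : ℝ) ≤ C' * (q : ℝ) * (listHeight L.dropLast : ℝ) ∧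
        L ++ [P] ∈ F}.Infinite)

/-- An injective enumeration which is nondecreasing up to an error `D` has its consecutive values
close to each other, and reaches consecutive integers at close times. -/
lemma quasiMonotone_bounds {N h D : ℕ} {a : ℕ → ℕ} (ha : ∀ s < N, a s < h)
    (hinj : ∀ s < N, ∀ t < N, a s = a t → s = t)
    (hD : ∀ s t, s ≤ t → t < N → a s ≤ a t + D) :
    (∀ s < N, ∀ t < N, a t = a s + 1 → |(t : ℤ) - s| ≤ 2 * D + 3) ∧
    (∀ s, s + 1 < N → |(a (s + 1) : ℤ) - a s| ≤ 2 * D + 3 + ((h : ℤ) - N)) := by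
  classical
  set r : ℕ → ℕ := fun x => ((Finset.range N).filter (fun t => a t < x)).card with hr
  have hfib : ∀ x y : ℕ, x ≤ y →
      ((Finset.range N).filter (fun t => x ≤ a t ∧ a t < y)).card ≤ y - x := by
    intro x y hxy
    rw [← Nat.card_Ico]
    refine Finset.card_le_card_of_injOn a ?_ ?_
    · intro t ht
      simp only [Finset.coe_filter, Finset.mem_range, Set.mem_ofPred_eq] at ht
      simpa using ht.2
    · intro s hs t ht hst
      simp only [Finset.coe_filter, Finset.mem_range, Set.mem_ofPred_eq] at hs ht
      exact hinj s hs.1 t ht.1 hst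
  have hstep : ∀ x y, x ≤ y → r y ≤ r x + (y - x) := by
    intro x y hxy
    calc r y ≤ (((Finset.range N).filter (fun t => a t < x)) ∪
          ((Finset.range N).filter (fun t => x ≤ a t ∧ a t < y))).card := by
          refine Finset.card_le_card ?_
          intro t ht
          simp only [Finset.mem_union, Finset.mem_filter, Finset.mem_range] at ht ⊢
          grind
      _ ≤ _ := (Finset.card_union_le _ _).trans (Nat.add_le_add_left (hfib x y hxy) _)
  have hmono : ∀ x y, x ≤ y → r x ≤ r y := by
    intro x y hxy
    refine Finset.card_le_card ?_
    intro t ht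
    simp only [Finset.mem_filter, Finset.mem_range] at ht ⊢
    grind
  have hr0 : r 0 = 0 := by simp [hr]
  have hrh : r h = N := by
    simp only [hr]
    rw [Finset.filter_true_of_mem, Finset.card_range]
    intro t ht
    exact ha t (Finset.mem_range.1 ht)
  have hclose : ∀ s < N, s ≤ r (a s) + (D + 1) ∧ r (a s) ≤ s + D := by
    intro s hs
    constructor
    · calc s = (Finset.range s).card := (Finset.card_range s).symm
        _ ≤ (((Finset.range N).filter (fun t => a t < a s)) ∪
          ((Finset.range N).filter (fun t => a s ≤ a t ∧ a t < a s + (D + 1)))).card := by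
            refine Finset.card_le_card ?_
            intro t ht
            have := hD t s (Finset.mem_range.1 ht).le hs
            simp only [Finset.mem_union, Finset.mem_filter, Finset.mem_range] at ht ⊢
            grind
        _ ≤ _ := (Finset.card_union_le _ _).trans
            (Nat.add_le_add_left ((hfib _ _ (by omega)).trans (by omega)) _)
    · calc r (a s) ≤ (Finset.range s ∪
          ((Finset.range N).filter (fun t => a s - D ≤ a t ∧ a t < a s))).card := by
            refine Finset.card_le_card ?_
            intro t ht
            simp only [Finset.mem_filter, Finset.mem_range, Finset.mem_union] at ht ⊢
            by_cases h1 : t < s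
            · exact Or.inl h1
            · have := hD s t (by omega) ht.1
              right; omega
        _ ≤ _ := (Finset.card_union_le _ _).trans (by
            rw [Finset.card_range]
            exact Nat.add_le_add_left ((hfib _ _ (by omega)).trans (by omega)) _)
  constructor
  · intro s hs t ht hst
    have h1 := hclose s hs
    have h2 := hclose t ht
    have h3 := hstep (a s) (a t) (by omega)
    have h4 := hmono (a s) (a t) (by omega)
    rw [abs_le]
    constructor <;> omega
  · intro s hs
    have h1 := hclose s (by omega)
    have h2 := hclose (s + 1) hs
    have h3 := hstep 0 (a s) (by omega)
    have h4 := hstep 0 (a (s + 1)) (by omega)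
    have h5 := hstep (a s) h (ha s (by omega)).le
    have h6 := hstep (a (s + 1)) h (ha _ hs).le
    have h7 := ha s (by omega)
    have h8 := ha _ hs
    rw [abs_le]
    constructor <;> omega

lemma exists_strictMonoOn_enumeration (s : Finset ℕ) :
    ∃ e : ℕ → ℕ, (∀ k l, k < l → l < s.card → e k < e l) ∧ (∀ k < s.card, e k ∈ s) ∧
      ∀ z ∈ s, ∃ k < s.card, e k = z := by
  refine ⟨fun k => if hk : k < s.card then s.orderEmbOfFin rfl ⟨k, hk⟩ else 0, ?_, ?_, ?_⟩
  · intro k l hkl hl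
    simp only [hl, hkl.trans hl, dif_pos]
    exact (s.orderEmbOfFin rfl).strictMono hkl
  · intro k hk
    simp only [hk, dif_pos]
    exact s.orderEmbOfFin_mem rfl _
  · intro z hz
    have : z ∈ Set.range (s.orderEmbOfFin rfl) := by
      rw [Finset.range_orderEmbOfFin]; exact hz
    obtain ⟨k, rfl⟩ := this
    exact ⟨k, k.2, by simp⟩

lemma start_add_le {h : ℕ} {c : ℕ → ℕ} (hc : ∀ i, c i + h ≤ c (i + 1)) {i k : ℕ} (hik : i < k) :
    c i + h ≤ c k := by
  induction k with
  | zero => omega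
  | succ k ih =>
    rcases Nat.lt_succ_iff_lt_or_eq.1 hik with h1 | rfl
    · have := ih h1; have := hc k; omega
    · exact hc i

lemma start_decomposition {h : ℕ} {c : ℕ → ℕ} (hc : ∀ i, c i + h ≤ c (i + 1)) {i k x y : ℕ}
    (hx : x < h) (hy : y < h) (hxy : c i + x = c k + y) : i = k ∧ x = y := by
  rcases lt_trichotomy i k with h1 | rfl | h1
  · have := start_add_le hc h1; omega
  · omega
  · have := start_add_le hc h1; omega

/-- Given `q` copies of an interval of length `h` inside an interval of length `h'`, starting at
`c 0, …, c (q - 1)`, and an injective enumeration `a` of part of `[0, h)`, there is an injective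
enumeration of part of `[0, h')` by blocks of length `H`, such that every copy of `a` is one of
the blocks, with control on the displacements. -/
lemma exists_block_enumeration {h H q Q h' : ℕ} {c a : ℕ → ℕ} (hH : 0 < H) (hHh : H < h)
    (ha : ∀ j < H, a j < h) (hinj : ∀ j < H, ∀ k < H, a j = a k → j = k)
    (hc : ∀ i, c i + h ≤ c (i + 1)) (hc' : ∀ i < q, c i + h ≤ h') (hqQ : q ≤ Q)
    (hQ : Q * H ≤ h') :
    ∃ b a' : ℕ → ℕ, (∀ i < q, b i < Q) ∧ (∀ i < q, ∀ k < q, b i = b k → i = k) ∧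
      (∀ s < Q * H, a' s < h') ∧ (∀ s < Q * H, ∀ t < Q * H, a' s = a' t → s = t) ∧
      (∀ i < q, ∀ j < H, a' (b i * H + j) = c i + a j) ∧
      (∀ s < Q * H, ∀ t < Q * H, a' t = a' s + 1 →
        |(t : ℤ) - s| ≤ 4 * (H * (2 * h + 1)) + 3 + ((h' : ℤ) - Q * H)) ∧
      (∀ s, s + 1 < Q * H →
        |(a' (s + 1) : ℤ) - a' s| ≤ 4 * (H * (2 * h + 1)) + 3 + ((h' : ℤ) - Q * H)) := by
  classical
  set O : Finset ℕ := (Finset.range q ×ˢ Finset.range H).image (fun z => c z.1 + a z.2) with hO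
  have hmemO : ∀ x, x ∈ O ↔ ∃ i < q, ∃ j < H, c i + a j = x := by
    intro x
    simp only [hO, Finset.mem_image, Finset.mem_product, Finset.mem_range, Prod.exists]
    grind
  set Λ : Finset ℕ := Finset.range h' \ O with hΛ
  obtain ⟨e, he_mono, he_mem, he_surj⟩ := exists_strictMonoOn_enumeration Λ
  have hcard : (Q - q) * H ≤ Λ.card := by
    have h1 : O.card ≤ q * H := by
      refine Finset.card_image_le.trans ?_
      simp
    have h2 : h' - O.card ≤ Λ.card := by
      have := Finset.le_card_sdiff O (Finset.range h')
      simpa using this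
    have h3 : (Q - q) * H = Q * H - q * H := Nat.sub_mul _ _ _
    omega
  -- a point of `[0, h)` missed by `a`
  obtain ⟨m, hm, hma⟩ : ∃ m < h, ∀ j < H, a j ≠ m := by
    by_contra! hcon
    have : (Finset.range h).card ≤ (Finset.range H).card := by
      refine Finset.card_le_card_of_surjOn a ?_
      intro m hm
      obtain ⟨j, hj, hjm⟩ := hcon m (by simpa using hm)
      exact ⟨j, by simpa using hj, hjm⟩
    simp at this
    omega
  have hrun : ∀ x y, x + 2 * h ≤ y → (∀ z, x ≤ z → z ≤ y → z ∈ O) → False := by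
    intro x y hxy hz
    obtain ⟨i, hi, j, hj, hx⟩ := (hmemO x).1 (hz x le_rfl (by omega))
    obtain ⟨i', hi', j', hj', hy⟩ := (hmemO y).1 (hz y (by omega) le_rfl)
    have h1 := ha j hj
    have h2 := ha j' hj'
    have hii' : i < i' := by
      rcases lt_trichotomy i i' with h3 | rfl | h3
      · exact h3
      · omega
      · have := start_add_le hc h3; omega
    have hstep := hc i
    rcases Nat.lt_or_ge (c i + h) (c (i + 1)) with hlt | hge
    · obtain ⟨l, hl, k, hk, hlk⟩ := (hmemO (c i + h)).1 (hz _ (by omega) (by omega))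
      have h4 := ha k hk
      rcases Nat.lt_or_ge i l with h3 | h3
      · rcases Nat.lt_or_ge (i + 1) l with h5 | h5
        · have := start_add_le hc h5; omega
        · have : l = i + 1 := by omega
          subst this; omega
      · rcases Nat.lt_or_ge l i with h5 | h5
        · have := start_add_le hc h5; omega
        · have : l = i := by omega
          subst this; omega
    · obtain ⟨l, hl, k, hk, hlk⟩ := (hmemO (c (i + 1) + m)).1 (hz _ (by omega) (by omega))
      exact hma k hk (start_decomposition hc (ha k hk) hm hlk).2
  have hgap : ∀ k, k + 1 < Λ.card → e (k + 1) ≤ e k + (2 * h + 1) := by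
    intro k hk
    by_contra! hcon
    refine hrun (e k + 1) (e (k + 1) - 1) (by omega) ?_
    intro z hz1 hz2
    by_contra hzO
    have hmem := he_mem (k + 1) hk
    have hzΛ : z ∈ Λ := by
      rw [hΛ, Finset.mem_sdiff, Finset.mem_range] at hmem ⊢
      exact ⟨by omega, hzO⟩
    obtain ⟨l, hl, rfl⟩ := he_surj z hzΛ
    rcases lt_trichotomy l k with h1 | rfl | h1
    · have := he_mono l k h1 (by omega); omega
    · omega
    · rcases Nat.lt_or_ge (k + 1) l with h2 | h2
      · have := he_mono _ _ h2 hl; omega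
      · have : l = k + 1 := by omega
        subst this; omega
  have hgap' : ∀ j k, k + j < Λ.card → e (k + j) ≤ e k + j * (2 * h + 1) := by
    intro j
    induction j with
    | zero => intro k _; simp
    | succ j ih =>
      intro k hk
      have h1 := ih k (by omega)
      have h2 := hgap (k + j) (by omega)
      rw [← add_assoc, Nat.succ_mul]
      omega
  set col : ℕ → ℕ → ℕ := fun i j => if i < q then c i + a j else e ((i - q) * H + j) with hcol
  have hidx : ∀ i < Q, q ≤ i → ∀ j < H, (i - q) * H + j < Λ.card := by
    intro i hi hqi j hj
    have : (i - q + 1) * H ≤ (Q - q) * H := Nat.mul_le_mul_right _ (by omega)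
    rw [Nat.succ_mul] at this
    omega
  have hcol_lt : ∀ i < Q, ∀ j < H, col i j < h' := by
    intro i hi j hj
    simp only [hcol]
    split_ifs with hiq
    · have := hc' i hiq; have := ha j hj; omega
    · have := he_mem _ (hidx i hi (by omega) j hj)
      rw [hΛ, Finset.mem_sdiff, Finset.mem_range] at this
      exact this.1
  have hdivmod : ∀ {i j k l : ℕ}, j < H → l < H → i * H + j = k * H + l → i = k ∧ j = l := by
    intro i j k l hj hl hijkl
    refine start_decomposition (h := H) (c := fun i => i * H) (fun i => ?_) hj hl hijkl
    simp only [Nat.succ_mul, le_refl]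
  have he_inj : ∀ k < Λ.card, ∀ l < Λ.card, e k = e l → k = l := by
    intro k hk l hl hkl
    rcases lt_trichotomy k l with h1 | h1 | h1
    · have := he_mono _ _ h1 hl; omega
    · exact h1
    · have := he_mono _ _ h1 hk; omega
  have hcol_inj : ∀ i < Q, ∀ j < H, ∀ k < Q, ∀ l < H, col i j = col k l → i = k ∧ j = l := by
    intro i hi j hj k hk l hl hijkl
    simp only [hcol] at hijkl
    split_ifs at hijkl with h1 h2 h2
    · obtain ⟨h3, h4⟩ := start_decomposition hc (ha j hj) (ha l hl) hijkl
      exact ⟨h3, hinj j hj l hl h4⟩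
    · exfalso
      have := he_mem _ (hidx k hk (by omega) l hl)
      rw [hΛ, Finset.mem_sdiff, hmemO] at this
      exact this.2 ⟨i, h1, j, hj, hijkl⟩
    · exfalso
      have := he_mem _ (hidx i hi (by omega) j hj)
      rw [hΛ, Finset.mem_sdiff, hmemO] at this
      exact this.2 ⟨k, h2, l, hl, hijkl.symm⟩
    · have := he_inj _ (hidx i hi (by omega) j hj) _ (hidx k hk (by omega) l hl) hijkl
      obtain ⟨h3, h4⟩ := hdivmod hj hl this
      exact ⟨by omega, h4⟩
  have hdiam : ∀ i < Q, ∀ j < H,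
      col i j ≤ col i 0 + H * (2 * h + 1) ∧ col i 0 ≤ col i j + H * (2 * h + 1) := by
    intro i hi j hj
    have hle : 1 * (2 * h + 1) ≤ H * (2 * h + 1) := Nat.mul_le_mul_right _ hH
    simp only [hcol]
    split_ifs with hiq
    · have := ha j hj; have := ha 0 hH; omega
    · have h1 := hidx i hi (by omega) j hj
      have h2 := hgap' j _ h1
      have h3 : j * (2 * h + 1) ≤ H * (2 * h + 1) := Nat.mul_le_mul_right _ hj.le
      refine ⟨by rw [Nat.add_zero]; omega, ?_⟩
      rcases Nat.eq_zero_or_pos j with rfl | hj0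
      · omega
      · have := he_mono ((i - q) * H + 0) _ (by omega) h1
        omega
  set π : Equiv.Perm (Fin Q) := Tuple.sort (fun i : Fin Q => col i 0) with hπ
  have hπ_mono : Monotone (fun i : Fin Q => col (π i) 0) :=
    Tuple.monotone_sort (fun i : Fin Q => col i 0)
  set g : ℕ → ℕ := fun i => if hi : i < Q then (π ⟨i, hi⟩ : ℕ) else 0 with hg
  have hg_eq : ∀ i (hi : i < Q), g i = π ⟨i, hi⟩ := fun i hi => by simp [hg, hi]
  have hg_lt : ∀ i < Q, g i < Q := fun i hi => by rw [hg_eq i hi]; exact (π ⟨i, hi⟩).2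
  have hg_inj : ∀ i < Q, ∀ k < Q, g i = g k → i = k := by
    intro i hi k hk hik
    rw [hg_eq i hi, hg_eq k hk] at hik
    have := π.injective (Fin.ext hik)
    simpa using this
  have hg_mono : ∀ i k, i ≤ k → k < Q → col (g i) 0 ≤ col (g k) 0 := by
    intro i k hik hk
    rw [hg_eq i (by omega), hg_eq k hk]
    exact hπ_mono (show (⟨i, by omega⟩ : Fin Q) ≤ ⟨k, hk⟩ from hik)
  have hdiv : ∀ s < Q * H, s / H < Q := fun s hs => Nat.div_lt_of_lt_mul (by rwa [mul_comm])
  have hmod : ∀ s, s % H < H := fun s => Nat.mod_lt _ hH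
  set a' : ℕ → ℕ := fun s => col (g (s / H)) (s % H) with ha'
  have ha'_lt : ∀ s < Q * H, a' s < h' := fun s hs =>
    hcol_lt _ (hg_lt _ (hdiv s hs)) _ (hmod s)
  have ha'_inj : ∀ s < Q * H, ∀ t < Q * H, a' s = a' t → s = t := by
    intro s hs t ht hst
    obtain ⟨h1, h2⟩ := hcol_inj _ (hg_lt _ (hdiv s hs)) _ (hmod s) _ (hg_lt _ (hdiv t ht)) _
      (hmod t) hst
    have h3 := hg_inj _ (hdiv s hs) _ (hdiv t ht) h1
    rw [← Nat.div_add_mod s H, ← Nat.div_add_mod t H, h2, h3]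
  have ha'_mono : ∀ s t, s ≤ t → t < Q * H → a' s ≤ a' t + 2 * (H * (2 * h + 1)) := by
    intro s t hst ht
    have h1 := (hdiam _ (hg_lt _ (hdiv s (by omega))) _ (hmod s)).1
    have h2 := (hdiam _ (hg_lt _ (hdiv t ht)) _ (hmod t)).2
    have h3 := hg_mono _ _ (Nat.div_le_div_right (c := H) hst) (hdiv t ht)
    simp only [ha']
    omega
  obtain ⟨hT, hS⟩ := quasiMonotone_bounds ha'_lt ha'_inj ha'_mono
  refine ⟨fun i => if hi : i < Q then (π.symm ⟨i, hi⟩ : ℕ) else 0, a', ?_, ?_, ha'_lt, ha'_inj,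
    ?_, ?_, ?_⟩
  · intro i hi
    simp only [show i < Q by omega, dif_pos]
    exact (π.symm _).2
  · intro i hi k hk hik
    simp only [show i < Q by omega, show k < Q by omega, dif_pos] at hik
    have := π.symm.injective (Fin.ext hik)
    simpa using this
  · intro i hi j hj
    have hiQ : i < Q := by omega
    simp only [hiQ, dif_pos, ha']
    have h1 : ((π.symm ⟨i, hiQ⟩ : ℕ) * H + j) / H = (π.symm ⟨i, hiQ⟩ : ℕ) := by
      rw [mul_comm, Nat.mul_add_div hH, Nat.div_eq_of_lt hj, add_zero]
    have h2 : ((π.symm ⟨i, hiQ⟩ : ℕ) * H + j) % H = j := by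
      rw [mul_comm, Nat.mul_add_mod, Nat.mod_eq_of_lt hj]
    rw [h1, h2, hg_eq _ (π.symm ⟨i, hiQ⟩).2]
    simp [hcol, hi]
  · intro s hs t ht hst
    refine (hT s hs t ht hst).trans ?_
    have : (Q : ℤ) * H ≤ h' := by exact_mod_cast hQ
    push_cast
    linarith
  · intro s hs
    refine (hS s hs).trans ?_
    push_cast
    linarith

lemma le_mul_one_add_rpow_of_smallOCbrt {φ : ℝ → ℝ} (hφ : SmallOCbrt φ) :
    ∃ K : ℝ, 1 ≤ K ∧ ∀ n : ℕ, φ n ≤ K * (1 + (n : ℝ) ^ ((1 : ℝ) / 3)) := by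
  have h1 : ∀ᶠ t : ℝ in atTop, φ t / t ^ ((1 : ℝ) / 3) < 1 := hφ.eventually_lt_const one_pos
  obtain ⟨N, hN⟩ := eventually_atTop.1 (tendsto_natCast_atTop_atTop.eventually
    (h1.and (eventually_gt_atTop (0 : ℝ))))
  refine ⟨1 + ∑ n ∈ Finset.range N, |φ n|, by
    linarith [Finset.sum_nonneg (fun n (_ : n ∈ Finset.range N) => abs_nonneg (φ n))], ?_⟩
  intro n
  have hs : 0 ≤ ∑ n ∈ Finset.range N, |φ n| := Finset.sum_nonneg fun n _ => abs_nonneg _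
  have hp : 0 ≤ (n : ℝ) ^ ((1 : ℝ) / 3) := by positivity
  rcases Nat.lt_or_ge n N with h | h
  · have h2 : |φ n| ≤ ∑ n ∈ Finset.range N, |φ n| :=
      Finset.single_le_sum (f := fun n : ℕ => |φ n|) (fun n _ => abs_nonneg _)
        (Finset.mem_range.2 h)
    have := le_abs_self (φ n)
    nlinarith [mul_nonneg hs hp]
  · obtain ⟨h2, h3⟩ := hN n h
    rw [div_lt_one (by positivity)] at h2
    nlinarith [mul_nonneg hs hp]

lemma eventually_cost_le (K A B ε : ℝ) (hε : 0 < ε) :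
    ∀ᶠ h : ℕ in atTop,
      K * (1 + (A * (h : ℝ) ^ 2) ^ ((1 : ℝ) / 3)) * (B / h) ≤ ε := by
  have h1 : Tendsto (fun h : ℕ => ((h : ℝ))⁻¹) atTop (𝓝 0) := tendsto_inv_atTop_nhds_zero_nat
  have h2 : Tendsto (fun h : ℕ => ((h : ℝ)) ^ (-((1 : ℝ) / 3))) atTop (𝓝 0) :=
    (tendsto_rpow_neg_atTop (by norm_num)).comp tendsto_natCast_atTop_atTop
  have h3 : Tendsto (fun h : ℕ => |K| * |B| * (((h : ℝ))⁻¹ +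
      |A| ^ ((1 : ℝ) / 3) * ((h : ℝ)) ^ (-((1 : ℝ) / 3)))) atTop (𝓝 0) := by
    have := ((h1.add (h2.const_mul (|A| ^ ((1 : ℝ) / 3)))).const_mul (|K| * |B|))
    simpa using this
  filter_upwards [h3.eventually_lt_const hε, eventually_gt_atTop 0] with h hh h0
  have hpos : (0 : ℝ) < h := by exact_mod_cast h0
  refine le_trans ?_ hh.le
  have e1 : ((h : ℝ)) ^ (-((1 : ℝ) / 3)) = ((h : ℝ) ^ 2) ^ ((1 : ℝ) / 3) * (h : ℝ)⁻¹ := by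
    rw [← Real.rpow_natCast, ← Real.rpow_mul hpos.le, ← Real.rpow_neg_one, ← Real.rpow_add hpos]
    norm_num
  have e2 : |(A * (h : ℝ) ^ 2) ^ ((1 : ℝ) / 3)| ≤
      |A| ^ ((1 : ℝ) / 3) * ((h : ℝ) ^ 2) ^ ((1 : ℝ) / 3) := by
    rw [← Real.mul_rpow (abs_nonneg _) (by positivity)]
    refine (Real.abs_rpow_le_abs_rpow _ _).trans (le_of_eq ?_)
    rw [abs_mul, abs_of_nonneg (show (0 : ℝ) ≤ (h : ℝ) ^ 2 by positivity)]
  calc K * (1 + (A * (h : ℝ) ^ 2) ^ ((1 : ℝ) / 3)) * (B / h)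
      ≤ |K * (1 + (A * (h : ℝ) ^ 2) ^ ((1 : ℝ) / 3)) * (B / h)| := le_abs_self _
    _ = |K| * |B| * (|1 + (A * (h : ℝ) ^ 2) ^ ((1 : ℝ) / 3)| * (h : ℝ)⁻¹) := by
        rw [abs_mul, abs_mul, abs_div, abs_of_pos hpos]; ring
    _ ≤ |K| * |B| * ((1 + |A| ^ ((1 : ℝ) / 3) * ((h : ℝ) ^ 2) ^ ((1 : ℝ) / 3)) * (h : ℝ)⁻¹) := by
        gcongr
        refine (abs_add_le _ _).trans ?_
        rw [abs_one]
        gcongr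
    _ = _ := by rw [e1]; ring

lemma heights_pos (p : ℕ → CSParam) (n : ℕ) : 0 < heights p n := by
  induction n with
  | zero => simp [heights]
  | succ n ih =>
    have := (p n).two_le_q
    simp only [heights]
    positivity

lemma listHeight_ofFn (p : ℕ → CSParam) (n : ℕ) :
    listHeight (List.ofFn fun k : Fin n => p k) = heights p n := by
  induction n with
  | zero => simp [listHeight, heights]
  | succ n ih =>
    rw [List.ofFn_succ_last]
    simp only [listHeight, List.foldl_append, List.foldl_cons, List.foldl_nil, heights]
    simp only [listHeight] at ih
    simp only [Fin.val_last, Fin.val_castSucc, ih]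

/-- In a flexible family one can choose the cutting parameters above any prescribed threshold
depending on the past. -/
lemma exists_parameters {F : Set (List CSParam)} {C' : ℝ}
    (h2 : ∃ P : CSParam, [P] ∈ F ∧ 3 ≤ P.q)
    (h3 : ∀ L : List CSParam, L ∈ F → L ≠ [] →
      {q : ℕ | ∃ P : CSParam, P.q = q ∧
        (P.σtot : ℝ) ≤ C' * (q : ℝ) * (listHeight L.dropLast : ℝ) ∧ L ++ [P] ∈ F}.Infinite)
    (Θ : ℕ → ℕ → ℕ) :
    ∃ p : ℕ → CSParam, 3 ≤ (p 0).q ∧ (∀ n, (List.ofFn fun k : Fin (n + 1) => p k.val) ∈ F) ∧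
      (∀ n, Θ n (heights p (n + 1)) ≤ (p (n + 1)).q) ∧
      ∀ n, ((p (n + 1)).σtot : ℝ) ≤ C' * ((p (n + 1)).q : ℝ) * (heights p n : ℝ) := by
  obtain ⟨P₀, hP₀, hq₀⟩ := h2
  have hext : ∀ (n : ℕ) (L : {L : List CSParam // L ∈ F ∧ L ≠ []}), ∃ P : CSParam,
      Θ n (listHeight L.1) ≤ P.q ∧
      (P.σtot : ℝ) ≤ C' * (P.q : ℝ) * (listHeight L.1.dropLast : ℝ) ∧ L.1 ++ [P] ∈ F := by
    intro n L
    obtain ⟨q, ⟨P, rfl, hP⟩, hq⟩ := (h3 L.1 L.2.1 L.2.2).exists_gt (Θ n (listHeight L.1))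
    exact ⟨P, hq.le, hP⟩
  choose next hnext using hext
  let Ls : ℕ → {L : List CSParam // L ∈ F ∧ L ≠ []} := fun n =>
    Nat.rec ⟨[P₀], hP₀, by simp⟩
      (fun n L => ⟨L.1 ++ [next n L], (hnext n L).2.2, by simp⟩) n
  let p : ℕ → CSParam := fun n => (Ls n).1.getLast (Ls n).2.2
  have hp : ∀ n, p (n + 1) = next n (Ls n) := fun n => by
    change ((Ls n).1 ++ [next n (Ls n)]).getLast _ = _
    simp
  have hofFn : ∀ n, (List.ofFn fun k : Fin (n + 1) => p k.val) = (Ls n).1 := by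
    intro n
    induction n with
    | zero => simp [p, Ls]
    | succ n ih =>
      rw [List.ofFn_succ_last]
      simp only [Fin.val_castSucc, Fin.val_last, ih, hp]
      rfl
  have hheight : ∀ n, listHeight (Ls n).1 = heights p (n + 1) := fun n => by
    rw [← hofFn, listHeight_ofFn]
  have hdrop : ∀ n, listHeight (Ls n).1.dropLast = heights p n := fun n => by
    rw [← hofFn, List.ofFn_succ_last, List.dropLast_concat]
    exact listHeight_ofFn p n
  refine ⟨p, hq₀, fun n => by rw [hofFn]; exact (Ls n).2.1, fun n => ?_, fun n => ?_⟩
  · rw [hp, ← hheight]; exact (hnext n (Ls n)).1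
  · rw [hp, ← hdrop]; exact (hnext n (Ls n)).2.1

/-- The heights `Q 0 * ⋯ * Q (n - 1)` of the towers of the odometer with cutting parameters `Q`. -/
def partialProd (Q : ℕ → ℕ) (n : ℕ) : ℕ := ∏ k ∈ Finset.range n, Q k

lemma partialProd_zero (Q : ℕ → ℕ) : partialProd Q 0 = 1 := rfl

lemma partialProd_succ (Q : ℕ → ℕ) (n : ℕ) : partialProd Q (n + 1) = Q n * partialProd Q n := by
  rw [partialProd, Finset.prod_range_succ, mul_comm, partialProd]

/-- The combinatorial data relating a cutting-and-stacking construction with parameters `p` and an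
odometer with cutting parameters `Q`: for `n ≥ 1`, the enumeration `a n` puts the levels of the
`n`-th tower of the odometer inside the `n`-th tower for `p`, and `b n i` is the block of the
`(n+1)`-th tower of the odometer which corresponds to the `i`-th subcolumn. -/
structure Scheme where
  p : ℕ → CSParam
  Q : ℕ → ℕ
  a : ℕ → ℕ → ℕ
  b : ℕ → ℕ → ℕ
  M : ℕ → ℕ
  w : ℕ → ℝ
  two_le_Q : ∀ n, 2 ≤ Q n
  a_lt : ∀ n, 1 ≤ n → ∀ j < partialProd Q n, a n j < heights p n
  a_inj : ∀ n, 1 ≤ n → ∀ j < partialProd Q n, ∀ k < partialProd Q n, a n j = a n k → j = k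
  b_lt : ∀ n, 1 ≤ n → ∀ i < (p n).q, b n i < Q n
  b_inj : ∀ n, 1 ≤ n → ∀ i < (p n).q, ∀ k < (p n).q, b n i = b n k → i = k
  a_succ : ∀ n, 1 ≤ n → ∀ i < (p n).q, ∀ j < partialProd Q n,
    a (n + 1) (b n i * partialProd Q n + j) = colStart p n i + a n j
  T_bound : ∀ n, 1 ≤ n → ∀ s < partialProd Q (n + 1),
    ∀ t < partialProd Q (n + 1), a (n + 1) t = a (n + 1) s + 1 → |(t : ℤ) - s| ≤ M n
  S_bound : ∀ n, 1 ≤ n → ∀ s, s + 1 < partialProd Q (n + 1) →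
    |(a (n + 1) (s + 1) : ℤ) - a (n + 1) s| ≤ M n
  w_nonneg : ∀ n, 0 ≤ w n
  summable_w : Summable w
  new_le : ∀ n, 2 ≤ n → ((Q n : ℝ) - (p n).q) / Q n ≤ w n
  unused_le : ∀ n, 2 ≤ n → ((heights p n : ℝ) - (partialProd Q n : ℕ) + 1) /
    (partialProd Q n : ℕ) ≤ w n

/-- Heights of the odometer associated with the heights `h`: they are as large as possible under
the constraints of being smaller than `h` and divisible enough. -/
def odometerHeight (h : ℕ → ℕ) : ℕ → ℕ
  | 0 => 1
  | 1 => 2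
  | n + 2 => (h (n + 2) - 1) / ((n + 2) * odometerHeight h (n + 1)) *
      ((n + 2) * odometerHeight h (n + 1))

/-- Cutting parameters of the odometer with heights `odometerHeight h`. -/
def odometerCut (h : ℕ → ℕ) : ℕ → ℕ
  | 0 => 2
  | n + 1 => (h (n + 2) - 1) / ((n + 2) * odometerHeight h (n + 1)) * (n + 2)

lemma odometerHeight_succ (h : ℕ → ℕ) (n : ℕ) :
    odometerHeight h (n + 1) = odometerCut h n * odometerHeight h n := by
  cases n with
  | zero => simp [odometerHeight, odometerCut]
  | succ n => simp only [odometerHeight, odometerCut]; ring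

lemma partialProd_odometerCut (h : ℕ → ℕ) (n : ℕ) :
    partialProd (odometerCut h) n = odometerHeight h n := by
  induction n with
  | zero => simp [odometerHeight, partialProd_zero]
  | succ n ih => rw [partialProd_succ, ih, odometerHeight_succ]

lemma colStart_add_le (p : ℕ → CSParam) (n i : ℕ) :
    colStart p n i + heights p n ≤ colStart p n (i + 1) := by
  simp only [colStart]
  rw [Finset.sum_range_succ _ (i + 1), Nat.succ_mul]
  omega

lemma colStart_add_le_heights (p : ℕ → CSParam) (n : ℕ) {i : ℕ} (hi : i < (p n).q) :
    colStart p n i + heights p n ≤ heights p (n + 1) := by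
  have h1 : ∑ j ∈ Finset.range (i + 1), (p n).σ j ≤ (p n).σtot :=
    Finset.sum_le_sum_of_subset (Finset.range_subset_range.2 (by omega))
  have h2 : (i + 1) * heights p n ≤ (p n).q * heights p n := Nat.mul_le_mul_right _ hi
  simp only [colStart, heights]
  rw [Nat.succ_mul] at h2
  omega

lemma odometerHeight_lt {p : ℕ → CSParam} (hq0 : 3 ≤ (p 0).q) (n : ℕ) :
    odometerHeight (heights p) (n + 1) < heights p (n + 1) := by
  cases n with
  | zero =>
    simp only [odometerHeight, heights]
    omega
  | succ n =>
    have h1 := Nat.div_mul_le_self (heights p (n + 2) - 1)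
      ((n + 2) * odometerHeight (heights p) (n + 1))
    have h2 := heights_pos p (n + 2)
    simp only [odometerHeight]
    change _ < heights p (n + 2)
    omega

lemma heights_le_odometerHeight_add {p : ℕ → CSParam} (n : ℕ)
    (hpos : 0 < odometerHeight (heights p) (n + 1)) :
    heights p (n + 2) ≤ odometerHeight (heights p) (n + 2) +
      (n + 2) * odometerHeight (heights p) (n + 1) := by
  have h1 := Nat.lt_div_mul_add (a := heights p (n + 2) - 1)
    (b := (n + 2) * odometerHeight (heights p) (n + 1)) (by positivity)
  have h2 := heights_pos p (n + 2)
  simp only [odometerHeight]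
  omega

lemma q_le_odometerCut {p : ℕ → CSParam} (hq0 : 3 ≤ (p 0).q)
    (hq : ∀ n, (n + 2) * heights p (n + 1) ≤ (p (n + 1)).q) (n : ℕ) :
    0 < odometerHeight (heights p) (n + 1) ∧
      (p (n + 1)).q ≤ odometerCut (heights p) (n + 1) := by
  have key : ∀ n, 0 < odometerHeight (heights p) (n + 1) →
      (p (n + 1)).q ≤ odometerCut (heights p) (n + 1) := by
    intro n hpos
    have h1 := heights_le_odometerHeight_add n hpos
    rw [odometerHeight_succ] at h1
    have h2 : (p (n + 1)).q * heights p (n + 1) ≤ heights p (n + 2) := Nat.le_add_right _ _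
    have h3 := odometerHeight_lt hq0 n
    have h4 : (n + 2) * odometerHeight (heights p) (n + 1) ≤ (p (n + 1)).q :=
      (Nat.mul_le_mul_left _ h3.le).trans (hq n)
    have h5 : (p (n + 1)).q * (odometerHeight (heights p) (n + 1) + 1) ≤
        (p (n + 1)).q * heights p (n + 1) := Nat.mul_le_mul_left _ h3
    rw [mul_add, mul_one] at h5
    exact Nat.le_of_mul_le_mul_right (by omega) hpos
  induction n with
  | zero => exact ⟨by simp [odometerHeight], key 0 (by simp [odometerHeight])⟩
  | succ n ih =>
    have : 0 < odometerHeight (heights p) (n + 2) := by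
      rw [odometerHeight_succ]
      exact Nat.mul_pos ((by have := (p (n + 1)).two_le_q; omega : 0 < (p (n + 1)).q).trans_le ih.2)
        ih.1
    exact ⟨this, key _ this⟩

lemma heights_le_two_mul_odometerHeight {p : ℕ → CSParam} (hq0 : 3 ≤ (p 0).q)
    (hq : ∀ n, (n + 2) * heights p (n + 1) ≤ (p (n + 1)).q) (n : ℕ) :
    heights p (n + 2) ≤ 2 * odometerHeight (heights p) (n + 2) := by
  obtain ⟨hpos, hle⟩ := q_le_odometerCut hq0 hq n
  have h1 := heights_le_odometerHeight_add n hpos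
  have h2 : n + 2 ≤ odometerCut (heights p) (n + 1) :=
    (Nat.le_mul_of_pos_right _ (heights_pos p (n + 1))).trans ((hq n).trans hle)
  have h3 : (n + 2) * odometerHeight (heights p) (n + 1) ≤ odometerHeight (heights p) (n + 2) := by
    rw [odometerHeight_succ _ (n + 1)]
    exact Nat.mul_le_mul_right _ h2
  omega

/-- The blocks of the odometer towers can be chosen compatibly with all the subcolumns. -/
lemma exists_enumerations {p : ℕ → CSParam} (hq0 : 3 ≤ (p 0).q)
    (hq : ∀ n, (n + 2) * heights p (n + 1) ≤ (p (n + 1)).q) :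
    ∃ a b : ℕ → ℕ → ℕ,
      (∀ n, 1 ≤ n → (∀ j < odometerHeight (heights p) n, a n j < heights p n) ∧
        ∀ j < odometerHeight (heights p) n, ∀ k < odometerHeight (heights p) n,
          a n j = a n k → j = k) ∧
      ∀ n, 1 ≤ n → (∀ i < (p n).q, b n i < odometerCut (heights p) n) ∧
        (∀ i < (p n).q, ∀ k < (p n).q, b n i = b n k → i = k) ∧
        (∀ i < (p n).q, ∀ j < odometerHeight (heights p) n,
          a (n + 1) (b n i * odometerHeight (heights p) n + j) = colStart p n i + a n j) ∧
        (∀ s < odometerHeight (heights p) (n + 1), ∀ t < odometerHeight (heights p) (n + 1),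
          a (n + 1) t = a (n + 1) s + 1 → |(t : ℤ) - s| ≤ ((15 + n) * heights p n ^ 2 : ℕ)) ∧
        (∀ s, s + 1 < odometerHeight (heights p) (n + 1) →
          |(a (n + 1) (s + 1) : ℤ) - a (n + 1) s| ≤ ((15 + n) * heights p n ^ 2 : ℕ)) := by
  set H := odometerHeight (heights p) with hH
  set Q := odometerCut (heights p) with hQ
  let E : ℕ → Type := fun n => {a : ℕ → ℕ // (∀ j < H (n + 1), a j < heights p (n + 1)) ∧
    ∀ j < H (n + 1), ∀ k < H (n + 1), a j = a k → j = k}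
  have hstep : ∀ (n : ℕ) (e : E n), ∃ (b : ℕ → ℕ) (e' : E (n + 1)),
      (∀ i < (p (n + 1)).q, b i < Q (n + 1)) ∧
      (∀ i < (p (n + 1)).q, ∀ k < (p (n + 1)).q, b i = b k → i = k) ∧
      (∀ i < (p (n + 1)).q, ∀ j < H (n + 1),
        e'.1 (b i * H (n + 1) + j) = colStart p (n + 1) i + e.1 j) ∧
      (∀ s < H (n + 2), ∀ t < H (n + 2), e'.1 t = e'.1 s + 1 →
        |(t : ℤ) - s| ≤ ((16 + n) * heights p (n + 1) ^ 2 : ℕ)) ∧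
      (∀ s, s + 1 < H (n + 2) →
        |(e'.1 (s + 1) : ℤ) - e'.1 s| ≤ ((16 + n) * heights p (n + 1) ^ 2 : ℕ)) := by
    rintro n ⟨a, ha, hinj⟩
    obtain ⟨hpos, hle⟩ := q_le_odometerCut hq0 hq n
    have hlt := odometerHeight_lt hq0 n
    have hlt' := odometerHeight_lt hq0 (n + 1)
    have hadd := heights_le_odometerHeight_add n hpos
    rw [← hH] at hpos hlt hlt' hadd
    have hsucc : H (n + 2) = Q (n + 1) * H (n + 1) := odometerHeight_succ _ _
    obtain ⟨b, a', hb, hb_inj, ha', ha'_inj, hab, hT, hS⟩ :=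
      exists_block_enumeration hpos hlt ha hinj (colStart_add_le p (n + 1))
        (fun i hi => colStart_add_le_heights p (n + 1) hi) hle (hsucc ▸ hlt'.le)
    rw [← hsucc] at ha' ha'_inj hT hS
    have hM : 4 * ((H (n + 1) : ℤ) * (2 * heights p (n + 1) + 1)) + 3 +
        ((heights p (n + 2) : ℤ) - Q (n + 1) * H (n + 1)) ≤
        ((16 + n) * heights p (n + 1) ^ 2 : ℕ) := by
      rw [hsucc] at hadd
      have h1 : (H (n + 1) : ℤ) + 1 ≤ heights p (n + 1) := by exact_mod_cast hlt
      have h2 : (1 : ℤ) ≤ H (n + 1) := by exact_mod_cast hpos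
      have h3 : (heights p (n + 2) : ℤ) ≤ Q (n + 1) * H (n + 1) + (n + 2) * H (n + 1) := by
        exact_mod_cast hadd
      push_cast
      nlinarith [mul_nonneg (by positivity : (0 : ℤ) ≤ n) (by nlinarith :
        (0 : ℤ) ≤ (heights p (n + 1) : ℤ) ^ 2 - H (n + 1))]
    exact ⟨b, ⟨a', ha', ha'_inj⟩, hb, hb_inj, hab,
      fun s hs t ht hst => (hT s hs t ht hst).trans hM, fun s hs => (hS s hs).trans hM⟩
  choose nb ne hnb using hstep
  let e₀ : E 0 := ⟨id, fun j hj => hj.trans (odometerHeight_lt hq0 0), fun _ _ _ _ h => h⟩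
  let e : (n : ℕ) → E n := fun n => Nat.rec e₀ (fun n e => ne n e) n
  refine ⟨fun n => (e (n - 1)).1, fun n => nb (n - 1) (e (n - 1)), ?_, ?_⟩
  · rintro (_ | n) hn
    · omega
    · exact (e n).2
  · rintro (_ | n) hn
    · omega
    · have := hnb n (e n)
      rw [show 16 + n = 15 + (n + 1) by omega] at this
      exact this

/-- A flexible family contains parameters satisfying condition (F), together with a scheme relating
them to the universal odometer, with quantitative bounds adapted to `φ`. -/
lemma exists_scheme {φ : ℝ → ℝ} (hφ : SmallOCbrt φ) {F : Set (List CSParam)} {C' : ℝ}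
    (hC' : 0 < C') (h2 : ∃ P : CSParam, [P] ∈ F ∧ 3 ≤ P.q)
    (h3 : ∀ L : List CSParam, L ∈ F → L ≠ [] →
      {q : ℕ | ∃ P : CSParam, P.q = q ∧
        (P.σtot : ℝ) ≤ C' * (q : ℝ) * (listHeight L.dropLast : ℝ) ∧ L ++ [P] ∈ F}.Infinite) :
    ∃ 𝔖 : Scheme, CondF 𝔖.p ∧ (∀ n, (List.ofFn fun k : Fin (n + 1) => 𝔖.p k.val) ∈ F) ∧
      (∀ N, 0 < N → ∃ n, N ∣ partialProd 𝔖.Q n) ∧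
      ∃ Φ : ℕ → ℝ, (∀ n, 0 ≤ Φ n) ∧ (∀ n, ∀ t : ℕ, t ≤ 𝔖.M n → φ t ≤ Φ n) ∧
        Summable fun n => Φ n * 𝔖.w n := by
  obtain ⟨K, hK1, hK⟩ := le_mul_one_add_rpow_of_smallOCbrt hφ
  have hΘ : ∀ n g : ℕ, ∃ N : ℕ, ∀ h ≥ N, K * (1 + ((17 + n : ℝ) * (h : ℝ) ^ 2) ^ ((1 : ℝ) / 3)) *
      (2 * (n + 4 + C') * g / h) ≤ (1 / 2) ^ n := fun n g =>
    eventually_atTop.1 (eventually_cost_le K _ _ _ (by positivity))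
  choose Θ hΘ using hΘ
  obtain ⟨p, hq0, hpF, hpΘ, hpσ⟩ := exists_parameters h2 h3
    (fun n g => max (Θ n g) ((n + 2) * g))
  have hq : ∀ n, (n + 2) * heights p (n + 1) ≤ (p (n + 1)).q :=
    fun n => (le_max_right _ _).trans (hpΘ n)
  have hheights : ∀ n, Θ n (heights p (n + 1)) ≤ heights p (n + 2) := fun n =>
    ((le_max_left _ _).trans (hpΘ n)).trans
      ((Nat.le_mul_of_pos_right _ (heights_pos p (n + 1))).trans (Nat.le_add_right _ _))
  have hhpos : ∀ n, (0 : ℝ) < heights p n := fun n => by exact_mod_cast heights_pos p n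
  obtain ⟨a, b, ha, hb⟩ := exists_enumerations hq0 hq
  set w : ℕ → ℝ := fun n =>
    if n < 2 then 0 else 2 * (n + 2 + C') * heights p (n - 1) / heights p n with hw
  have hw_succ : ∀ n, w (n + 2) = 2 * (n + 4 + C') * heights p (n + 1) / heights p (n + 2) := by
    intro n
    simp only [hw, show ¬ (n + 2 < 2) by omega, if_false]
    push_cast
    ring_nf
  have hw_nonneg : ∀ n, 0 ≤ w n := by
    intro n
    simp only [hw]
    split_ifs
    · exact le_rfl
    · have := hhpos (n - 1); have := hhpos n; positivity
  set Φ : ℕ → ℝ := fun n =>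
    K * (1 + (((15 + n) * heights p n ^ 2 : ℕ) : ℝ) ^ ((1 : ℝ) / 3)) with hΦ
  have hΦ1 : ∀ n, 1 ≤ Φ n := fun n => by
    have : (0 : ℝ) ≤ (((15 + n) * heights p n ^ 2 : ℕ) : ℝ) ^ ((1 : ℝ) / 3) := by positivity
    simp only [hΦ]
    nlinarith
  have hΦw : ∀ n, Φ (n + 2) * w (n + 2) ≤ (1 / 2) ^ n := by
    intro n
    have := hΘ n (heights p (n + 1)) _ (hheights n)
    rw [hw_succ]
    simp only [hΦ]
    push_cast
    rw [show (15 + ((n : ℝ) + 2)) = 17 + n by ring]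
    exact this
  have hgeo : Summable fun n : ℕ => ((1 : ℝ) / 2) ^ n := summable_geometric_two
  have hsumΦw : Summable fun n => Φ n * w n :=
    (summable_nat_add_iff 2).1 (Summable.of_nonneg_of_le
      (fun n => mul_nonneg (zero_le_one.trans (hΦ1 _)) (hw_nonneg _)) hΦw hgeo)
  have hsumw : Summable w := Summable.of_nonneg_of_le hw_nonneg
    (fun n => le_mul_of_one_le_left (hw_nonneg n) (hΦ1 n)) hsumΦw
  have hlt := odometerHeight_lt hq0
  have hQ : ∀ n, (p (n + 1)).q ≤ odometerCut (heights p) (n + 1) :=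
    fun n => (q_le_odometerCut hq0 hq n).2
  have hHpos : ∀ n, 0 < odometerHeight (heights p) (n + 1) :=
    fun n => (q_le_odometerCut hq0 hq n).1
  have hhalf := heights_le_two_mul_odometerHeight hq0 hq
  refine ⟨⟨p, odometerCut (heights p), a, b, fun n => (15 + n) * heights p n ^ 2, w, ?_, ?_, ?_,
    fun n hn => (hb n hn).1, fun n hn => (hb n hn).2.1, ?_, ?_, ?_, hw_nonneg, hsumw, ?_, ?_⟩,
    ?_, hpF, ?_, Φ, fun n => zero_le_one.trans (hΦ1 n), ?_, hsumΦw⟩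
  · rintro (_ | n)
    · exact le_rfl
    · exact (p (n + 1)).two_le_q.trans (hQ n)
  · simp only [partialProd_odometerCut]; exact fun n hn => (ha n hn).1
  · simp only [partialProd_odometerCut]; exact fun n hn => (ha n hn).2
  · simp only [partialProd_odometerCut]; exact fun n hn => (hb n hn).2.2.1
  · simp only [partialProd_odometerCut]; exact fun n hn => (hb n hn).2.2.2.1
  · simp only [partialProd_odometerCut]; exact fun n hn => (hb n hn).2.2.2.2
  · intro n hn
    obtain ⟨n, rfl⟩ := Nat.exists_eq_add_of_le' hn
    have hq2 : (0 : ℝ) < (p (n + 2)).q := by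
      exact_mod_cast (by have := (p (n + 2)).two_le_q; omega : 0 < (p (n + 2)).q)
    have hQq : ((p (n + 2)).q : ℝ) ≤ odometerCut (heights p) (n + 2) := by
      exact_mod_cast hQ (n + 1)
    have hQ0 := hq2.trans_le hQq
    have hH0 : (0 : ℝ) < odometerHeight (heights p) (n + 2) := by exact_mod_cast hHpos (n + 1)
    have e1 : (odometerCut (heights p) (n + 2) : ℝ) * odometerHeight (heights p) (n + 2) ≤
        (p (n + 2)).q * heights p (n + 2) + (p (n + 2)).σtot := by
      rw [← Nat.cast_mul, ← odometerHeight_succ]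
      exact_mod_cast (hlt (n + 2)).le
    have e2 : (heights p (n + 2) : ℝ) ≤ odometerHeight (heights p) (n + 2) +
        (n + 2) * heights p (n + 1) := by
      have := heights_le_odometerHeight_add n (hHpos n)
      have h' : (n + 2) * odometerHeight (heights p) (n + 1) ≤ (n + 2) * heights p (n + 1) :=
        Nat.mul_le_mul_left _ (hlt n).le
      exact_mod_cast this.trans (Nat.add_le_add_left h' _)
    have e3 := hpσ (n + 1)
    have e4 : (heights p (n + 2) : ℝ) ≤ 2 * odometerHeight (heights p) (n + 2) := by
      exact_mod_cast hhalf n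
    have e5 : ((odometerCut (heights p) (n + 2) : ℝ) - (p (n + 2)).q) *
        odometerHeight (heights p) (n + 2) ≤
        (p (n + 2)).q * ((n + 2 + C') * heights p (n + 1)) := by
      have := mul_le_mul_of_nonneg_left e2 hq2.le
      linarith
    have hh1 := hhpos (n + 1)
    rw [hw_succ, div_le_div_iff₀ hQ0 (hhpos _)]
    have hn0 : (0 : ℝ) ≤ n := by positivity
    have e6 : 0 ≤ (odometerCut (heights p) (n + 2) : ℝ) - (p (n + 2)).q := by linarith
    calc ((odometerCut (heights p) (n + 2) : ℝ) - (p (n + 2)).q) * heights p (n + 2)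
        ≤ ((odometerCut (heights p) (n + 2) : ℝ) - (p (n + 2)).q) *
          (2 * odometerHeight (heights p) (n + 2)) := mul_le_mul_of_nonneg_left e4 e6
      _ ≤ 2 * ((p (n + 2)).q * ((n + 2 + C') * heights p (n + 1))) := by linarith
      _ ≤ 2 * (odometerCut (heights p) (n + 2) * ((n + 4 + C') * heights p (n + 1))) := by
          gcongr
          norm_num
      _ = _ := by ring
  · simp only [partialProd_odometerCut]
    intro n hn
    obtain ⟨n, rfl⟩ := Nat.exists_eq_add_of_le' hn
    have hH0 : (0 : ℝ) < odometerHeight (heights p) (n + 2) := by exact_mod_cast hHpos (n + 1)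
    have e2 : (heights p (n + 2) : ℝ) ≤ odometerHeight (heights p) (n + 2) +
        (n + 2) * heights p (n + 1) := by
      have := heights_le_odometerHeight_add n (hHpos n)
      have h' : (n + 2) * odometerHeight (heights p) (n + 1) ≤ (n + 2) * heights p (n + 1) :=
        Nat.mul_le_mul_left _ (hlt n).le
      exact_mod_cast this.trans (Nat.add_le_add_left h' _)
    have e4 : (heights p (n + 2) : ℝ) ≤ 2 * odometerHeight (heights p) (n + 2) := by
      exact_mod_cast hhalf n
    have e5 : (1 : ℝ) ≤ heights p (n + 1) := by exact_mod_cast heights_pos p (n + 1)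
    have hn0 : (0 : ℝ) ≤ n := by positivity
    rw [hw_succ, div_le_div_iff₀ hH0 (hhpos _)]
    calc ((heights p (n + 2) : ℝ) - odometerHeight (heights p) (n + 2) + 1) * heights p (n + 2)
        ≤ ((n + 4 + C') * heights p (n + 1)) * heights p (n + 2) := by
          gcongr
          nlinarith
      _ ≤ ((n + 4 + C') * heights p (n + 1)) * (2 * odometerHeight (heights p) (n + 2)) := by
          gcongr
      _ = _ := by ring
  · refine (summable_nat_add_iff 2).1 (Summable.of_nonneg_of_le
      (fun n => by positivity) (fun n => ?_)
      ((summable_nat_add_iff 2).2 hsumw))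
    have hq2 : (0 : ℝ) < (p (n + 2)).q := by
      exact_mod_cast (by have := (p (n + 2)).two_le_q; omega : 0 < (p (n + 2)).q)
    have hh1 := hhpos (n + 1)
    have hh2 := hhpos (n + 2)
    have hh3 : ((p (n + 2)).q : ℝ) * heights p (n + 2) ≤ heights p (n + 3) := by
      exact_mod_cast (Nat.le_add_right _ _ : (p (n + 2)).q * heights p (n + 2) ≤ heights p (n + 3))
    change ((p (n + 2)).σtot : ℝ) / heights p (n + 3) ≤ w (n + 2)
    rw [hw_succ]
    calc ((p (n + 2)).σtot : ℝ) / heights p (n + 3)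
        ≤ (C' * (p (n + 2)).q * heights p (n + 1)) / ((p (n + 2)).q * heights p (n + 2)) := by
          gcongr
          exact hpσ (n + 1)
      _ = C' * heights p (n + 1) / heights p (n + 2) := by field_simp
      _ ≤ _ := by
          gcongr
          have : (0 : ℝ) ≤ n := by positivity
          linarith
  · intro N hN
    simp only [partialProd_odometerCut]
    rcases Nat.lt_or_ge N 2 with h | h
    · exact ⟨0, by rw [show N = 1 by omega]; exact one_dvd _⟩
    · obtain ⟨n, rfl⟩ := Nat.exists_eq_add_of_le' h
      exact ⟨n + 2, Dvd.dvd.mul_left (Dvd.intro _ rfl) _⟩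
  · intro n t ht
    refine (hK t).trans ?_
    simp only [hΦ]
    gcongr

lemma partialProd_pos {Q : ℕ → ℕ} (hQ : ∀ n, 2 ≤ Q n) (n : ℕ) : 0 < partialProd Q n :=
  Finset.prod_pos fun k _ => by have := hQ k; omega

lemma lt_partialProd {Q : ℕ → ℕ} (hQ : ∀ n, 2 ≤ Q n) (n : ℕ) : n < partialProd Q n := by
  induction n with
  | zero => exact partialProd_pos hQ 0
  | succ n ih =>
    rw [partialProd_succ]
    have := Nat.mul_le_mul_right (partialProd Q n) (hQ n)
    omega

lemma partialProd_dvd (Q : ℕ → ℕ) {m n : ℕ} (h : m ≤ n) : partialProd Q m ∣ partialProd Q n :=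
  Finset.prod_dvd_prod_of_subset _ _ _ (Finset.range_subset_range.2 h)

/-- The compatible sequences of residues modulo the numbers `partialProd Q n`. -/
def odometerRing (Q : ℕ → ℕ) : Subring (Π n, ZMod (partialProd Q n)) :=
  ⨅ n, RingHom.eqLocus
    ((ZMod.castHom (partialProd_dvd Q n.le_succ) (ZMod (partialProd Q n))).comp
      (Pi.evalRingHom _ (n + 1)))
    (Pi.evalRingHom _ n)

/-- The space of the odometer with cutting parameters `Q`. -/
def OdometerSpace (Q : ℕ → ℕ) : Type := odometerRing Q

noncomputable instance (Q : ℕ → ℕ) : CommRing (OdometerSpace Q) :=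
  inferInstanceAs (CommRing (odometerRing Q))

instance (Q : ℕ → ℕ) : TopologicalSpace (OdometerSpace Q) :=
  inferInstanceAs (TopologicalSpace (odometerRing Q))

instance (Q : ℕ → ℕ) : IsTopologicalRing (OdometerSpace Q) :=
  inferInstanceAs (IsTopologicalRing (odometerRing Q))

instance (Q : ℕ → ℕ) : T2Space (OdometerSpace Q) :=
  inferInstanceAs (T2Space (odometerRing Q))

instance (Q : ℕ → ℕ) : MeasurableSpace (OdometerSpace Q) :=
  inferInstanceAs (MeasurableSpace (odometerRing Q))

instance (n : ℕ) : Countable (ZMod n) :=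
  match n with
  | 0 => inferInstanceAs (Countable ℤ)
  | n + 1 => inferInstanceAs (Countable (Fin (n + 1)))

instance (Q : ℕ → ℕ) : SecondCountableTopology (OdometerSpace Q) :=
  have : ∀ n, SecondCountableTopology (ZMod (partialProd Q n)) := fun _ =>
    DiscreteTopology.secondCountableTopology_of_countable
  TopologicalSpace.Subtype.secondCountableTopology _

instance (Q : ℕ → ℕ) : BorelSpace (OdometerSpace Q) :=
  have : ∀ n, SecondCountableTopology (ZMod (partialProd Q n)) := fun _ =>
    DiscreteTopology.secondCountableTopology_of_countable
  inferInstanceAs (BorelSpace (odometerRing Q))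

lemma isClosed_odometerRing (Q : ℕ → ℕ) :
    IsClosed (odometerRing Q : Set (Π n, ZMod (partialProd Q n))) := by
  rw [odometerRing, Subring.coe_iInf]
  exact isClosed_iInter fun n => isClosed_eq
    ((continuous_of_discreteTopology (f := ZMod.castHom (partialProd_dvd Q n.le_succ)
      (ZMod (partialProd Q n)))).comp (continuous_apply (n + 1))) (continuous_apply n)

instance (Q : ℕ → ℕ) : StandardBorelSpace (OdometerSpace Q) :=
  (isClosed_odometerRing Q).measurableSet.standardBorel

/-- The residue modulo `partialProd Q n`, that is, the index of the level of the `n`-th tower. -/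
def address {Q : ℕ → ℕ} (n : ℕ) (x : OdometerSpace Q) : ℕ := (x.1 n).val

lemma address_lt {Q : ℕ → ℕ} (hQ : ∀ n, 2 ≤ Q n) (n : ℕ) (x : OdometerSpace Q) :
    address n x < partialProd Q n := by
  have : NeZero (partialProd Q n) := ⟨(partialProd_pos hQ n).ne'⟩
  exact ZMod.val_lt _

lemma address_succ_mod {Q : ℕ → ℕ} (hQ : ∀ n, 2 ≤ Q n) (n : ℕ) (x : OdometerSpace Q) :
    address (n + 1) x % partialProd Q n = address n x := by
  have : NeZero (partialProd Q n) := ⟨(partialProd_pos hQ n).ne'⟩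
  have : NeZero (partialProd Q (n + 1)) := ⟨(partialProd_pos hQ (n + 1)).ne'⟩
  have hx := x.2
  simp only [odometerRing, Subring.mem_iInf] at hx
  have h : ZMod.castHom (partialProd_dvd Q n.le_succ) (ZMod (partialProd Q n)) (x.1 (n + 1)) =
    x.1 n := hx n
  rw [ZMod.castHom_apply, ZMod.cast_eq_val] at h
  rw [address, address, ← h, ZMod.val_natCast]

lemma address_mod {Q : ℕ → ℕ} (hQ : ∀ n, 2 ≤ Q n) {m n : ℕ} (h : m ≤ n) (x : OdometerSpace Q) :
    address n x % partialProd Q m = address m x := by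
  induction n, h using Nat.le_induction with
  | base => exact Nat.mod_eq_of_lt (address_lt hQ m x)
  | succ n h ih => rw [← ih, ← address_succ_mod hQ n, Nat.mod_mod_of_dvd _ (partialProd_dvd Q h)]

lemma address_ext {Q : ℕ → ℕ} (hQ : ∀ n, 2 ≤ Q n) {x y : OdometerSpace Q} (N : ℕ)
    (h : ∀ n, N ≤ n → address n x = address n y) : x = y := by
  have : ∀ n, NeZero (partialProd Q n) := fun n => ⟨(partialProd_pos hQ n).ne'⟩
  refine Subtype.ext (funext fun n => ZMod.val_injective _ ?_)
  change address n x = address n y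
  rw [← address_mod hQ (le_max_left n N), h _ (le_max_right n N), address_mod hQ (le_max_left n N)]

lemma address_add_intCast {Q : ℕ → ℕ} (hQ : ∀ n, 2 ≤ Q n) (n : ℕ) (x : OdometerSpace Q) (c : ℤ) :
    (address n (x + (c : OdometerSpace Q)) : ℤ) = (address n x + c) % partialProd Q n := by
  have : NeZero (partialProd Q n) := ⟨(partialProd_pos hQ n).ne'⟩
  have h : (x + (c : OdometerSpace Q)).1 n = ((address n x + c : ℤ) : ZMod (partialProd Q n)) := by
    rw [Int.cast_add, Int.cast_natCast, address, ZMod.natCast_zmod_val]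
    rfl
  rw [address, h, ZMod.val_intCast]

lemma address_add_natCast {Q : ℕ → ℕ} (hQ : ∀ n, 2 ≤ Q n) (n : ℕ) (x : OdometerSpace Q) {c : ℤ}
    (h0 : 0 ≤ address n x + c) (h1 : address n x + c < partialProd Q n) :
    (address n (x + (c : OdometerSpace Q)) : ℤ) = address n x + c := by
  rw [address_add_intCast hQ, Int.emod_eq_of_lt h0 h1]

lemma measurable_address {Q : ℕ → ℕ} (n : ℕ) :
    Measurable (address n : OdometerSpace Q → ℕ) :=
  (measurable_of_countable (ZMod.val : ZMod (partialProd Q n) → ℕ)).comp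
    ((measurable_pi_apply n).comp
      (measurable_subtype_coe (p := (· ∈ odometerRing Q))))

lemma intCast_injective {Q : ℕ → ℕ} (hQ : ∀ n, 2 ≤ Q n) :
    Function.Injective (Int.cast : ℤ → OdometerSpace Q) := by
  refine (injective_iff_map_eq_zero (Int.castRingHom (OdometerSpace Q))).2 fun c hc => ?_
  by_contra hc0
  have h1 := address_add_intCast hQ c.natAbs 0 c
  have h2 := address_add_intCast hQ c.natAbs (0 : OdometerSpace Q) 0
  rw [show (c : OdometerSpace Q) = ((0 : ℤ) : OdometerSpace Q) by simpa using hc, h2,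
    add_zero] at h1
  have h3 : (partialProd Q c.natAbs : ℤ) ∣ c := by
    simpa using Int.ModEq.dvd (h1 : _ ≡ _ [ZMOD _])
  exact hc0 (Int.eq_zero_of_dvd_of_natAbs_lt_natAbs h3
    (by simpa using lt_partialProd hQ c.natAbs))

lemma measurable_of_address {Q : ℕ → ℕ} (hQ : ∀ n, 2 ≤ Q n) {Y : Type*} [MeasurableSpace Y]
    {f : Y → OdometerSpace Q} (N : ℕ)
    (h : ∀ n, N ≤ n → ∀ j < partialProd Q n, MeasurableSet {y | address n (f y) = j}) :
    Measurable f := by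
  have hm : ∀ n, Measurable fun y => address n (f y) := by
    intro n
    have h1 : Measurable fun y => address (max n N) (f y) := by
      refine measurable_to_countable' fun j => ?_
      by_cases hj : j < partialProd Q (max n N)
      · exact h _ (le_max_right _ _) j hj
      · convert MeasurableSet.empty
        ext y
        have := address_lt hQ (max n N) (f y)
        simp only [mem_preimage, mem_singleton_iff, mem_empty_iff_false, iff_false]
        omega
    have h2 : (fun y => address n (f y)) =
        (fun j => j % partialProd Q n) ∘ fun y => address (max n N) (f y) :=
      funext fun y => (address_mod hQ (le_max_left _ _) _).symm
    rw [h2]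
    exact measurable_from_top.comp h1
  refine Measurable.subtype_mk (p := (· ∈ odometerRing Q)) (f := fun y => (f y).1)
    (h := fun y => (f y).2) (measurable_pi_lambda _ fun n => ?_)
  have : NeZero (partialProd Q n) := ⟨(partialProd_pos hQ n).ne'⟩
  have h2 : (fun y => (f y).1 n) =
      (fun j : ℕ => (j : ZMod (partialProd Q n))) ∘ fun y => address n (f y) :=
    funext fun y => (ZMod.natCast_zmod_val _).symm
  rw [h2]
  exact measurable_from_top.comp (hm n)

lemma exists_invariant_measure {Q : ℕ → ℕ} (hQ : ∀ n, 2 ≤ Q n) :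
    ∃ μ : Measure (OdometerSpace Q), IsProbabilityMeasure μ ∧
      ∀ c : OdometerSpace Q, MeasurePreserving (· + c) μ μ := by
  have : ∀ n, NeZero (partialProd Q n) := fun n => ⟨(partialProd_pos hQ n).ne'⟩
  have : CompactSpace (OdometerSpace Q) :=
    isCompact_iff_compactSpace.1 (isClosed_odometerRing Q).isCompact
  refine ⟨Measure.addHaarMeasure ⊤, ⟨?_⟩, fun c => measurePreserving_add_right _ c⟩
  exact Measure.addHaarMeasure_self
    (K₀ := (⊤ : TopologicalSpace.PositiveCompacts (OdometerSpace Q)))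

section Measure

variable {Q : ℕ → ℕ} {μ : Measure (OdometerSpace Q)}

/-- A bijection which translates every point by an integer preserves the measure. -/
lemma measurePreserving_of_eq_add (hμ : ∀ c : OdometerSpace Q, MeasurePreserving (· + c) μ μ)
    (T : OdometerSpace Q ≃ᵐ OdometerSpace Q) {c : OdometerSpace Q → ℤ} (hc : Measurable c)
    (hT : ∀ x, T x = x + (c x : OdometerSpace Q)) : MeasurePreserving T μ μ := by
  refine ⟨T.measurable, Measure.ext fun E hE => ?_⟩
  rw [Measure.map_apply T.measurable hE]
  have hD : ∀ k : ℤ, MeasurableSet (c ⁻¹' {k} ∩ T ⁻¹' E) := fun k =>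
    (hc (measurableSet_singleton k)).inter (T.measurable hE)
  have h1 : (⋃ k : ℤ, c ⁻¹' {k} ∩ T ⁻¹' E) = T ⁻¹' E := by
    ext x; simp
  have hdisj : Pairwise (Function.onFun Disjoint fun k : ℤ => c ⁻¹' {k} ∩ T ⁻¹' E) :=
    fun i k hik => disjoint_left.2 fun x hi hk => hik (hi.1.symm.trans hk.1)
  have h2 : ∀ k : ℤ, μ (T '' (c ⁻¹' {k} ∩ T ⁻¹' E)) = μ (c ⁻¹' {k} ∩ T ⁻¹' E) := by
    intro k
    have : c ⁻¹' {k} ∩ T ⁻¹' E =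
        (· + (k : OdometerSpace Q)) ⁻¹' (T '' (c ⁻¹' {k} ∩ T ⁻¹' E)) := by
      ext x
      simp only [mem_preimage, mem_image]
      constructor
      · intro hx
        exact ⟨x, hx, by rw [hT, show c x = k from hx.1]⟩
      · rintro ⟨y, hy, hyx⟩
        rw [hT, show c y = k from hy.1] at hyx
        rwa [← add_right_cancel hyx]
    conv_rhs => rw [this]
    rw [(hμ _).measure_preimage (T.measurableSet_image.2 (hD k)).nullMeasurableSet]
  calc μ (T ⁻¹' E) = ∑' k, μ (c ⁻¹' {k} ∩ T ⁻¹' E) := by rw [← measure_iUnion hdisj hD, h1]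
    _ = ∑' k, μ (T '' (c ⁻¹' {k} ∩ T ⁻¹' E)) := by simp_rw [h2]
    _ = μ E := by
      rw [← measure_iUnion (fun i k hik => (disjoint_image_iff T.injective).2 (hdisj hik))
        (fun k => T.measurableSet_image.2 (hD k)), ← image_iUnion, h1,
        image_preimage_eq _ T.surjective]

variable [IsProbabilityMeasure μ]

lemma measureReal_address_eq (hQ : ∀ n, 2 ≤ Q n)
    (hμ : ∀ c : OdometerSpace Q, MeasurePreserving (· + c) μ μ) (n : ℕ) {j : ℕ}
    (hj : j < partialProd Q n) : μ.real {x | address n x = j} = 1 / partialProd Q n := by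
  have hmeas : ∀ j : ℕ, MeasurableSet {x : OdometerSpace Q | address n x = j} := fun j =>
    measurable_address n (measurableSet_singleton j)
  have h0 : ∀ j < partialProd Q n,
      μ.real {x | address n x = j} = μ.real {x | address n x = 0} := by
    intro j hj
    have h1 : {x : OdometerSpace Q | address n x = 0} =
        (· + ((j : ℤ) : OdometerSpace Q)) ⁻¹' {x | address n x = j} := by
      ext x
      have h2 := address_add_intCast hQ n x j
      have h3 := address_lt hQ n x
      simp only [mem_preimage, mem_ofPred_eq]
      constructor
      · intro h
        rw [h, Int.emod_eq_of_lt (by simp) (by simpa using hj)] at h2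
        simpa using h2
      · intro h
        rw [h] at h2
        have h4 : (j : ℤ) ≡ address n x + j [ZMOD partialProd Q n] := by
          rw [Int.ModEq, ← h2, Int.emod_eq_of_lt (by simp) (by simpa using hj)]
        have h5 := h4.dvd
        rw [add_sub_cancel_right, Int.natCast_dvd_natCast] at h5
        exact Nat.eq_zero_of_dvd_of_lt h5 h3
    rw [h1, measureReal_def, measureReal_def, (hμ _).measure_preimage (hmeas j).nullMeasurableSet]
  have h1 : (⋃ j ∈ Finset.range (partialProd Q n), {x : OdometerSpace Q | address n x = j}) =
      univ := by
    ext x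
    simpa using address_lt hQ n x
  have h2 : μ.real (⋃ j ∈ Finset.range (partialProd Q n), {x | address n x = j}) =
      ∑ j ∈ Finset.range (partialProd Q n), μ.real {x | address n x = j} :=
    measureReal_biUnion_finset (fun i _ k _ hik => disjoint_left.2 fun x hi hk =>
      hik (by rw [← show address n x = i from hi, show address n x = k from hk]))
      (fun j _ => hmeas j)
  rw [h1, probReal_univ, Finset.sum_congr rfl fun j hj => h0 j (Finset.mem_range.1 hj),
    Finset.sum_const, Finset.card_range, nsmul_eq_mul] at h2
  have h3 : (0 : ℝ) < partialProd Q n := by exact_mod_cast partialProd_pos hQ n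
  rw [h0 j hj, eq_div_iff h3.ne', mul_comm, ← h2]

lemma measureReal_address_le (hQ : ∀ n, 2 ≤ Q n)
    (hμ : ∀ c : OdometerSpace Q, MeasurePreserving (· + c) μ μ) (n : ℕ) (P : ℕ → Prop)
    [DecidablePred P] : μ.real {x | P (address n x)} ≤
      ((Finset.range (partialProd Q n)).filter P).card / partialProd Q n := by
  have h1 : {x : OdometerSpace Q | P (address n x)} ⊆
      ⋃ j ∈ (Finset.range (partialProd Q n)).filter P, {x | address n x = j} := by
    intro x hx
    simpa using ⟨address_lt hQ n x, hx⟩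
  refine (measureReal_mono h1 (measure_ne_top _ _)).trans
    ((measureReal_biUnion_finset_le _ _).trans_eq ?_)
  rw [Finset.sum_congr rfl fun j hj =>
    measureReal_address_eq hQ hμ n (Finset.mem_range.1 (Finset.mem_filter.1 hj).1),
    Finset.sum_const, nsmul_eq_mul, mul_one_div]

lemma noAtoms_of_invariant (hQ : ∀ n, 2 ≤ Q n)
    (hμ : ∀ c : OdometerSpace Q, MeasurePreserving (· + c) μ μ) : NullSingletonClass μ := by
  refine ⟨fun x => ?_⟩
  rw [← measureReal_eq_zero_iff]
  refine le_antisymm (ge_of_tendsto' tendsto_one_div_add_atTop_nhds_zero_nat fun n : ℕ => ?_)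
    measureReal_nonneg
  have h1 : ((n : ℝ) + 1) ≤ partialProd Q n := by exact_mod_cast lt_partialProd hQ n
  calc μ.real {x} ≤ μ.real {y | address n y = address n x} :=
        measureReal_mono (by simp)
    _ = 1 / partialProd Q n := measureReal_address_eq hQ hμ n (address_lt hQ n x)
    _ ≤ 1 / ((n : ℝ) + 1) := by gcongr

/-- A bound for the integral of `φ |c|`, when `|c|` is controlled outside of small events. -/
lemma integrable_comp_abs {φ : ℝ → ℝ} (hφ0 : ∀ t, 0 ≤ t → 0 ≤ φ t) {c : OdometerSpace Q → ℤ}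
    (hc : Measurable c) {E : ℕ → Set (OdometerSpace Q)} (hE : ∀ n, MeasurableSet (E n))
    {M : ℕ → ℕ} {w Φ : ℕ → ℝ} {K : ℝ} (hΦ0 : ∀ n, 0 ≤ Φ n)
    (hΦ : ∀ n, ∀ t : ℕ, t ≤ M n → φ t ≤ Φ n)
    (hsum : Summable fun n => Φ n * w n) (hEw : ∀ n, 2 ≤ n → μ.real (E n) ≤ K * w n)
    (hEev : ∀ᵐ x ∂μ, ∀ᶠ n in atTop, x ∉ E n)
    (hcM : ∀ᵐ x ∂μ, ∀ n, 1 ≤ n → (∀ m, n < m → x ∉ E m) → |c x| ≤ M n) :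
    Integrable (fun x => φ |(c x : ℝ)|) μ := by
  have hmeas : Measurable fun x => φ |(c x : ℝ)| :=
    (measurable_from_top (f := fun k : ℤ => φ |(k : ℝ)|)).comp hc
  refine ⟨hmeas.aestronglyMeasurable, ?_⟩
  rw [hasFiniteIntegral_iff_ofReal (ae_of_all _ fun x => hφ0 _ (abs_nonneg _))]
  have hpt : ∀ᵐ x ∂μ, ENNReal.ofReal (φ |(c x : ℝ)|) ≤ ENNReal.ofReal (Φ 1) +
      ∑' n, (E (n + 2)).indicator (fun _ => ENNReal.ofReal (Φ (n + 2))) x := by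
    filter_upwards [hEev, hcM] with x hx hxc
    have hbound : ∀ n, 1 ≤ n → (∀ m, n < m → x ∉ E m) → φ |(c x : ℝ)| ≤ Φ n := by
      intro n hn hm
      have h1 : |(c x : ℝ)| = ((c x).natAbs : ℝ) := by
        rw [← Int.cast_abs, Int.abs_eq_natAbs, Int.cast_natCast]
      rw [h1]
      refine hΦ n _ ?_
      have := hxc n hn hm
      rw [Int.abs_eq_natAbs] at this
      exact_mod_cast this
    obtain ⟨N, hN⟩ := eventually_atTop.1 hx
    classical
    have hex : ∃ n, ∀ m, n + 1 < m → x ∉ E m := ⟨N, fun m hm => hN m (by omega)⟩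
    rcases hn : Nat.find hex with _ | n
    · have := Nat.find_spec hex
      rw [hn] at this
      exact (ENNReal.ofReal_le_ofReal (hbound 1 le_rfl this)).trans le_self_add
    · have h1 := Nat.find_spec hex
      rw [hn] at h1
      have h2 := Nat.find_min hex (m := n) (by omega)
      have h3 : x ∈ E (n + 2) := by
        by_contra h3
        refine h2 fun m hm => ?_
        rcases (show n + 2 ≤ m by omega).eq_or_lt with h | h
        · rwa [← h]
        · exact h1 m h
      calc ENNReal.ofReal (φ |(c x : ℝ)|) ≤ ENNReal.ofReal (Φ (n + 2)) :=
            ENNReal.ofReal_le_ofReal (hbound (n + 2) (by omega) h1)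
        _ = (E (n + 2)).indicator (fun _ => ENNReal.ofReal (Φ (n + 2))) x :=
            by rw [indicator_of_mem h3]
        _ ≤ ∑' n, (E (n + 2)).indicator (fun _ => ENNReal.ofReal (Φ (n + 2))) x :=
            ENNReal.le_tsum n
        _ ≤ _ := le_add_self
  refine (lintegral_mono_ae hpt).trans_lt ?_
  rw [lintegral_add_left measurable_const, lintegral_const, measure_univ, mul_one,
    lintegral_tsum fun n => (measurable_const.indicator (hE _)).aemeasurable]
  simp_rw [lintegral_indicator_const (hE _)]
  refine ENNReal.add_lt_top.2 ⟨ENNReal.ofReal_lt_top, ?_⟩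
  have hsum' : Summable fun n => K * (Φ (n + 2) * w (n + 2)) :=
    ((summable_nat_add_iff 2).2 hsum).mul_left K
  refine (ENNReal.tsum_le_tsum fun n => ?_).trans_lt hsum'.tsum_ofReal_lt_top
  rw [← ofReal_measureReal, ← ENNReal.ofReal_mul (hΦ0 _)]
  refine ENNReal.ofReal_le_ofReal ?_
  calc Φ (n + 2) * μ.real (E (n + 2)) ≤ Φ (n + 2) * (K * w (n + 2)) :=
        mul_le_mul_of_nonneg_left (hEw _ (by omega)) (hΦ0 _)
    _ = _ := by ring

end Measure

namespace Scheme

variable {𝔖 : Scheme}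

/-- The space on which the dynamics associated with a scheme take place. -/
abbrev Space (𝔖 : Scheme) : Type := OdometerSpace 𝔖.Q

/-- The height of a point in the `n`-th tower, provided that it lies above the corresponding
level of the odometer. -/
def level (n : ℕ) (x : 𝔖.Space) : ℕ := 𝔖.a n (address n x)

/-- The `n`-th tower of the odometer is contained, above `x`, in a subcolumn of the `(n+1)`-th
tower. -/
def IsOld (n : ℕ) (x : 𝔖.Space) : Prop :=
  ∃ i < (𝔖.p n).q, address (n + 1) x = 𝔖.b n i * partialProd 𝔖.Q n + address n x

/-- At stage `n`, the point `x` is in an old block, and has successors for both dynamics as well as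
a predecessor for the rank-one dynamics. -/
structure IsGood (n : ℕ) (x : 𝔖.Space) : Prop where
  isOld : IsOld n x
  next : ∃ t < partialProd 𝔖.Q n, 𝔖.a n t = level n x + 1
  prev : ∃ t < partialProd 𝔖.Q n, 𝔖.a n t + 1 = level n x
  succ_lt : address n x + 1 < partialProd 𝔖.Q n

/-- The point `y` is the image of `x` under the `l`-th iterate of the rank-one dynamics. -/
def Shift (l : ℤ) (x y : 𝔖.Space) : Prop :=
  ∀ᶠ m in atTop, (level m y : ℤ) = level m x + l

variable (𝔖) in
/-- The invariant set of full measure on which the rank-one dynamics is defined. -/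
def regular : Set 𝔖.Space := {x | ∀ j : ℤ, ∀ᶠ n in atTop, IsGood n (x + (j : 𝔖.Space))}

lemma Shift.trans {l k : ℤ} {x y z : 𝔖.Space} (h : Shift l x y) (h' : Shift k y z) :
    Shift (l + k) x z := by
  filter_upwards [h, h'] with m h1 h2
  omega

lemma Shift.symm {l : ℤ} {x y : 𝔖.Space} (h : Shift l x y) : Shift (-l) y x := by
  filter_upwards [h] with m h1
  omega

lemma shift_refl (x : 𝔖.Space) : Shift 0 x x := Eventually.of_forall fun m => by simp

lemma Shift.eq {x y : 𝔖.Space} (h : Shift 0 x y) : x = y := by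
  obtain ⟨N, hN⟩ := eventually_atTop.1 h
  refine address_ext 𝔖.two_le_Q (N + 1) fun n hn => ?_
  have h1 := hN n (by omega)
  exact 𝔖.a_inj n (by omega) _ (address_lt 𝔖.two_le_Q n x) _ (address_lt 𝔖.two_le_Q n y)
    (by rw [add_zero] at h1; exact_mod_cast h1.symm)

lemma Shift.unique_right {l : ℤ} {x y z : 𝔖.Space} (h : Shift l x y) (h' : Shift l x z) : y = z :=
  Shift.eq (by simpa using h.symm.trans h')

lemma Shift.unique {l k : ℤ} {x y : 𝔖.Space} (h : Shift l x y) (h' : Shift k x y) : l = k := by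
  obtain ⟨m, h1, h2⟩ := (h.and h').exists
  omega

lemma address_succ_add_of_isOld {n : ℕ} (hn : 1 ≤ n) {x : 𝔖.Space} {c : ℤ} (hx : IsOld n x)
    (h0 : 0 ≤ address n x + c) (h1 : address n x + c < partialProd 𝔖.Q n) :
    0 ≤ address (n + 1) x + c ∧ address (n + 1) x + c < partialProd 𝔖.Q (n + 1) ∧
      IsOld n (x + (c : 𝔖.Space)) ∧
      (level (n + 1) (x + (c : 𝔖.Space)) : ℤ) - level (n + 1) x =
        level n (x + (c : 𝔖.Space)) - level n x := by
  obtain ⟨i, hi, hxi⟩ := hx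
  have hb := 𝔖.b_lt n hn i hi
  have h2 : (𝔖.b n i + 1) * partialProd 𝔖.Q n ≤ partialProd 𝔖.Q (n + 1) := by
    rw [partialProd_succ]
    exact Nat.mul_le_mul_right _ hb
  have h3 : (((𝔖.b n i + 1) * partialProd 𝔖.Q n : ℕ) : ℤ) ≤ partialProd 𝔖.Q (n + 1) := by
    exact_mod_cast h2
  have h4 : (address (n + 1) x : ℤ) = 𝔖.b n i * partialProd 𝔖.Q n + address n x := by
    exact_mod_cast hxi
  push_cast at h3
  rw [add_mul, one_mul] at h3
  have h5 : (0 : ℤ) ≤ 𝔖.b n i * partialProd 𝔖.Q n := by positivity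
  have h6 : 0 ≤ address (n + 1) x + c := by omega
  have h7 : address (n + 1) x + c < partialProd 𝔖.Q (n + 1) := by omega
  have h8 := address_add_natCast 𝔖.two_le_Q n x h0 h1
  have h9 := address_add_natCast 𝔖.two_le_Q (n + 1) x h6 h7
  have h10 : address (n + 1) (x + (c : 𝔖.Space)) =
      𝔖.b n i * partialProd 𝔖.Q n + address n (x + (c : 𝔖.Space)) := by
    zify
    omega
  refine ⟨h6, h7, ⟨i, hi, h10⟩, ?_⟩
  rw [level, level, h10, hxi, 𝔖.a_succ n hn i hi _ (address_lt 𝔖.two_le_Q _ _),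
    𝔖.a_succ n hn i hi _ (address_lt 𝔖.two_le_Q _ _), level, level]
  push_cast
  ring

/-- The points all of whose blocks from the `n`-th one on are old. -/
def IsOldFrom (n : ℕ) (x : 𝔖.Space) : Prop := ∀ m, n ≤ m → IsOld m x

lemma IsOldFrom.add {n : ℕ} (hn : 1 ≤ n) {x : 𝔖.Space} {c : ℤ} (hx : IsOldFrom n x)
    (h0 : 0 ≤ address n x + c) (h1 : address n x + c < partialProd 𝔖.Q n) :
    IsOldFrom n (x + (c : 𝔖.Space)) ∧
      Shift (level n (x + (c : 𝔖.Space)) - level n x) x (x + (c : 𝔖.Space)) := by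
  have key : ∀ m, n ≤ m → (0 ≤ address m x + c ∧ address m x + c < partialProd 𝔖.Q m) ∧
      (level m (x + (c : 𝔖.Space)) : ℤ) - level m x =
        level n (x + (c : 𝔖.Space)) - level n x := by
    intro m hm
    induction m, hm using Nat.le_induction with
    | base => exact ⟨⟨h0, h1⟩, rfl⟩
    | succ m hm ih =>
      obtain ⟨h2, h3, -, h4⟩ :=
        address_succ_add_of_isOld (hn.trans hm) (hx m hm) ih.1.1 ih.1.2
      exact ⟨⟨h2, h3⟩, h4.trans ih.2⟩
  refine ⟨fun m hm => (address_succ_add_of_isOld (hn.trans hm) (hx m hm) (key m hm).1.1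
    (key m hm).1.2).2.2.1, ?_⟩
  filter_upwards [eventually_ge_atTop n] with m hm
  have := (key m hm).2
  omega

lemma IsOldFrom.address_add {n : ℕ} (hn : 1 ≤ n) {x : 𝔖.Space} (hx : IsOldFrom n x)
    {t : ℕ} (ht : t < partialProd 𝔖.Q n) {c : ℤ} (hc : c = t - address n x) :
    address n (x + (c : 𝔖.Space)) = t ∧ IsOldFrom n (x + (c : 𝔖.Space)) ∧
      Shift (𝔖.a n t - level n x) x (x + (c : 𝔖.Space)) := by
  have h0 : 0 ≤ (address n x : ℤ) + c := by omega
  have h1 : (address n x : ℤ) + c < partialProd 𝔖.Q n := by omega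
  have h2 := hx.add hn h0 h1
  have h3 := address_add_natCast 𝔖.two_le_Q n x h0 h1
  have h4 : address n (x + (c : 𝔖.Space)) = t := by omega
  refine ⟨h4, h2.1, ?_⟩
  have h5 := h2.2
  rwa [level, h4] at h5

lemma exists_isOldFrom {x : 𝔖.Space} (hx : x ∈ regular 𝔖) (N : ℕ) :
    ∃ n, 1 ≤ n ∧ N ≤ n ∧ ∀ m, n ≤ m → IsGood m x := by
  have h := hx 0
  rw [Int.cast_zero, add_zero] at h
  obtain ⟨n, hn⟩ := eventually_atTop.1 h
  exact ⟨max (max n N) 1, le_max_right _ _, (le_max_right _ _).trans (le_max_left _ _),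
    fun m hm => hn m (by omega)⟩

lemma add_intCast_mem_regular {x : 𝔖.Space} (hx : x ∈ regular 𝔖) (c : ℤ) :
    x + (c : 𝔖.Space) ∈ regular 𝔖 := by
  intro j
  rw [add_assoc, ← Int.cast_add]
  exact hx _

lemma exists_shift_one {x : 𝔖.Space} (hx : x ∈ regular 𝔖) :
    ∃ c : ℤ, Shift 1 x (x + (c : 𝔖.Space)) := by
  obtain ⟨n, hn, -, hgood⟩ := exists_isOldFrom hx 0
  obtain ⟨t, ht, hat⟩ := (hgood n le_rfl).next
  have h := (IsOldFrom.address_add hn (fun m hm => (hgood m hm).isOld) ht rfl).2.2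
  refine ⟨t - address n x, ?_⟩
  rwa [hat, Nat.cast_add, Nat.cast_one, add_sub_cancel_left] at h

lemma exists_shift_neg_one {x : 𝔖.Space} (hx : x ∈ regular 𝔖) :
    ∃ c : ℤ, Shift (-1) x (x + (c : 𝔖.Space)) := by
  obtain ⟨n, hn, -, hgood⟩ := exists_isOldFrom hx 0
  obtain ⟨t, ht, hat⟩ := (hgood n le_rfl).prev
  have h := (IsOldFrom.address_add hn (fun m hm => (hgood m hm).isOld) ht rfl).2.2
  refine ⟨t - address n x, ?_⟩
  rwa [← hat, Nat.cast_add, Nat.cast_one, sub_add_cancel_left] at h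

lemma exists_shift_add_one {x : 𝔖.Space} (hx : x ∈ regular 𝔖) :
    ∃ l : ℤ, Shift l x (x + 1) := by
  obtain ⟨n, hn, -, hgood⟩ := exists_isOldFrom hx 0
  have h := (hgood n le_rfl).succ_lt
  have := (IsOldFrom.add hn (c := 1) (fun m hm => (hgood m hm).isOld) (by omega) (by omega)).2
  rw [Int.cast_one] at this
  exact ⟨_, this⟩

lemma exists_shift_add_intCast {x : 𝔖.Space} (hx : x ∈ regular 𝔖) (c : ℤ) :
    ∃ l : ℤ, Shift l x (x + (c : 𝔖.Space)) := by
  induction c with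
  | zero => exact ⟨0, by simpa using shift_refl x⟩
  | succ c ih =>
    obtain ⟨l, hl⟩ := ih
    obtain ⟨k, hk⟩ := exists_shift_add_one (add_intCast_mem_regular hx c)
    exact ⟨_, by simpa [add_assoc] using hl.trans hk⟩
  | pred c ih =>
    obtain ⟨l, hl⟩ := ih
    obtain ⟨k, hk⟩ := exists_shift_add_one (add_intCast_mem_regular hx (-c - 1))
    rw [add_assoc, show (((-c - 1 : ℤ) : 𝔖.Space) + 1) = ((-c : ℤ) : 𝔖.Space) by simp] at hk
    exact ⟨_, hl.trans hk.symm⟩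

lemma measurableSet_eventually {Y : Type*} [MeasurableSpace Y] {P : ℕ → Y → Prop}
    (hP : ∀ n, MeasurableSet {y | P n y}) : MeasurableSet {y | ∀ᶠ n in atTop, P n y} := by
  have : {y | ∀ᶠ n in atTop, P n y} = ⋃ N, ⋂ n, ⋂ (_ : N ≤ n), {y | P n y} := by
    ext y
    simp [eventually_atTop]
  rw [this]
  exact .iUnion fun N => .iInter fun n => .iInter fun _ => hP n

lemma measurable_level (n : ℕ) : Measurable (level n : 𝔖.Space → ℕ) :=
  measurable_from_top.comp (measurable_address n)

lemma measurableSet_isOld (n : ℕ) : MeasurableSet {x : 𝔖.Space | IsOld n x} := by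
  have : {x : 𝔖.Space | IsOld n x} = (fun x => (address (n + 1) x, address n x)) ⁻¹'
    {z : ℕ × ℕ | ∃ i < (𝔖.p n).q, z.1 = 𝔖.b n i * partialProd 𝔖.Q n + z.2} := rfl
  rw [this]
  exact ((measurable_address _).prodMk (measurable_address _)) (Set.to_countable _).measurableSet

lemma measurableSet_isGood (n : ℕ) : MeasurableSet {x : 𝔖.Space | IsGood n x} := by
  have : {x : 𝔖.Space | IsGood n x} = {x : 𝔖.Space | IsOld n x} ∩ address n ⁻¹'
      {s : ℕ | (∃ t < partialProd 𝔖.Q n, 𝔖.a n t = 𝔖.a n s + 1) ∧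
        (∃ t < partialProd 𝔖.Q n, 𝔖.a n t + 1 = 𝔖.a n s) ∧ s + 1 < partialProd 𝔖.Q n} := by
    ext x
    exact ⟨fun h => ⟨h.1, h.2, h.3, h.4⟩, fun h => ⟨h.1, h.2.1, h.2.2.1, h.2.2.2⟩⟩
  rw [this]
  exact (measurableSet_isOld n).inter (measurable_address n (Set.to_countable _).measurableSet)

lemma measurableSet_regular : MeasurableSet (regular 𝔖) := by
  have : regular 𝔖 = ⋂ j : ℤ, (· + (j : 𝔖.Space)) ⁻¹' {x | ∀ᶠ n in atTop, IsGood n x} := by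
    ext x
    simp [regular]
  rw [this]
  exact .iInter fun j => (measurable_add_const _) (measurableSet_eventually measurableSet_isGood)

lemma measurableSet_shift {f g : 𝔖.Space → 𝔖.Space} (hf : Measurable f) (hg : Measurable g)
    {l : 𝔖.Space → ℤ} (hl : Measurable l) : MeasurableSet {x | Shift (l x) (f x) (g x)} := by
  refine measurableSet_eventually fun m => measurableSet_eq_fun ?_ ?_
  · exact measurable_from_top.comp ((measurable_level m).comp hg)
  · exact (measurable_from_top.comp ((measurable_level m).comp hf)).add hl

lemma measurableSet_isOldFrom (n : ℕ) : MeasurableSet {x : 𝔖.Space | IsOldFrom n x} := by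
  have : {x : 𝔖.Space | IsOldFrom n x} = ⋂ m, ⋂ (_ : n ≤ m), {x | IsOld m x} := by
    ext x
    simp [IsOldFrom]
  rw [this]
  exact .iInter fun m => .iInter fun _ => measurableSet_isOld m

end Scheme

open Classical in
/-- An integer satisfying `R`, if there is any. -/
noncomputable def someInt (R : ℤ → Prop) : ℤ := if h : ∃ c, R c then h.choose else 0

lemma someInt_spec {R : ℤ → Prop} (h : ∃ c, R c) : R (someInt R) := by
  rw [someInt, dif_pos h]
  exact h.choose_spec

lemma someInt_eq_zero {R : ℤ → Prop} (h : ¬ ∃ c, R c) : someInt R = 0 := dif_neg h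

lemma measurable_someInt {Y : Type*} [MeasurableSpace Y] {R : Y → ℤ → Prop}
    (hR : ∀ c, MeasurableSet {y | R y c}) (huniq : ∀ y c k, R y c → R y k → c = k) :
    Measurable fun y => someInt (R y) := by
  refine measurable_to_countable' fun c => ?_
  have : (fun y => someInt (R y)) ⁻¹' {c} =
      {y | R y c} ∪ ((⋃ k, {y | R y k})ᶜ ∩ {_y | c = 0}) := by
    ext y
    simp only [mem_preimage, mem_singleton_iff, mem_union, mem_ofPred_eq, mem_inter_iff,
      mem_compl_iff, mem_iUnion]
    by_cases h : ∃ k, R y k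
    · have h1 := someInt_spec h
      constructor
      · rintro rfl
        exact Or.inl h1
      · rintro (h2 | h2)
        · exact huniq _ _ _ h1 h2
        · exact absurd h h2.1
    · rw [someInt_eq_zero h]
      constructor
      · exact fun h2 => Or.inr ⟨h, h2.symm⟩
      · rintro (h2 | h2)
        · exact absurd ⟨c, h2⟩ h
        · exact h2.2.symm
  rw [this]
  exact (hR c).union ((MeasurableSet.iUnion hR).compl.inter (.const _))

namespace Scheme

variable {𝔖 : Scheme}

/-- The translation which has the effect of the `l`-th iterate of the rank-one dynamics. -/
noncomputable def displacement (l : ℤ) (x : 𝔖.Space) : ℤ :=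
  someInt fun c => x ∈ regular 𝔖 ∧ Shift l x (x + (c : 𝔖.Space))

lemma shift_displacement {l : ℤ} {x : 𝔖.Space} (hx : x ∈ regular 𝔖)
    (h : ∃ c : ℤ, Shift l x (x + (c : 𝔖.Space))) :
    Shift l x (x + (displacement l x : 𝔖.Space)) := by
  obtain ⟨c, hc⟩ := h
  exact (someInt_spec (R := fun c => x ∈ regular 𝔖 ∧ Shift l x (x + (c : 𝔖.Space)))
    ⟨c, hx, hc⟩).2

lemma displacement_of_notMem {l : ℤ} {x : 𝔖.Space} (hx : x ∉ regular 𝔖) : displacement l x = 0 :=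
  someInt_eq_zero fun ⟨_, h⟩ => hx h.1

lemma measurable_displacement (l : ℤ) : Measurable (displacement l : 𝔖.Space → ℤ) :=
  measurable_someInt
    (fun _ => measurableSet_regular.inter
      (measurableSet_shift measurable_id (measurable_add_const _) measurable_const))
    fun _ _ _ h h' =>
      intCast_injective 𝔖.two_le_Q (add_left_cancel (h.2.unique_right h'.2))

lemma measurable_add_displacement (l : ℤ) :
    Measurable fun x : 𝔖.Space => x + (displacement l x : 𝔖.Space) :=
  measurable_id.add (measurable_from_top.comp (measurable_displacement l))

lemma add_displacement_add_displacement {l : ℤ} (x : 𝔖.Space)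
    (h : ∀ x ∈ regular 𝔖, ∃ c : ℤ, Shift l x (x + (c : 𝔖.Space)))
    (h' : ∀ x ∈ regular 𝔖, ∃ c : ℤ, Shift (-l) x (x + (c : 𝔖.Space))) :
    x + (displacement l x : 𝔖.Space) +
      (displacement (-l) (x + (displacement l x : 𝔖.Space)) : 𝔖.Space) = x := by
  by_cases hx : x ∈ regular 𝔖
  · have h1 := shift_displacement hx (h x hx)
    have hy := add_intCast_mem_regular hx (displacement l x)
    have h2 := h1.trans (shift_displacement hy (h' _ hy))
    rw [add_neg_cancel] at h2
    exact h2.eq.symm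
  · have : x + (displacement l x : 𝔖.Space) = x := by simp [displacement_of_notMem hx]
    rw [this, displacement_of_notMem hx]
    simp

variable (𝔖) in
/-- The rank-one transformation associated with a scheme. -/
noncomputable def rankOneMap : 𝔖.Space ≃ᵐ 𝔖.Space where
  toFun x := x + (displacement 1 x : 𝔖.Space)
  invFun x := x + (displacement (-1) x : 𝔖.Space)
  left_inv x := add_displacement_add_displacement x (fun _ => exists_shift_one)
    (fun _ => exists_shift_neg_one)
  right_inv x := add_displacement_add_displacement (l := -1) x (fun _ => exists_shift_neg_one)
    (fun _ hx => by simpa using exists_shift_one hx)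
  measurable_toFun := measurable_add_displacement 1
  measurable_invFun := measurable_add_displacement (-1)

lemma rankOneMap_apply (x : 𝔖.Space) : rankOneMap 𝔖 x = x + (displacement 1 x : 𝔖.Space) := rfl

lemma rankOneMap_symm_apply (x : 𝔖.Space) :
    (rankOneMap 𝔖).symm x = x + (displacement (-1) x : 𝔖.Space) := rfl

lemma iterate_rankOneMap {x : 𝔖.Space} (hx : x ∈ regular 𝔖) (k : ℕ) :
    Shift k x ((rankOneMap 𝔖)^[k] x) ∧ ∃ c : ℤ, (rankOneMap 𝔖)^[k] x = x + (c : 𝔖.Space) := by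
  induction k with
  | zero => exact ⟨by simpa using shift_refl x, 0, by simp⟩
  | succ k ih =>
    obtain ⟨h, c, hc⟩ := ih
    have hy := add_intCast_mem_regular hx c
    rw [← hc] at hy
    rw [Function.iterate_succ_apply', rankOneMap_apply]
    refine ⟨?_, c + displacement 1 ((rankOneMap 𝔖)^[k] x), ?_⟩
    · rw [Nat.cast_add, Nat.cast_one]
      exact h.trans (shift_displacement hy (exists_shift_one hy))
    · rw [Int.cast_add, ← add_assoc, ← hc]

lemma iterate_rankOneMap_symm {x : 𝔖.Space} (hx : x ∈ regular 𝔖) (k : ℕ) :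
    Shift (-k) x ((rankOneMap 𝔖).symm^[k] x) ∧
      ∃ c : ℤ, (rankOneMap 𝔖).symm^[k] x = x + (c : 𝔖.Space) := by
  induction k with
  | zero => exact ⟨by simpa using shift_refl x, 0, by simp⟩
  | succ k ih =>
    obtain ⟨h, c, hc⟩ := ih
    have hy := add_intCast_mem_regular hx c
    rw [← hc] at hy
    rw [Function.iterate_succ_apply', rankOneMap_symm_apply]
    refine ⟨?_, c + displacement (-1) ((rankOneMap 𝔖).symm^[k] x), ?_⟩
    · rw [Nat.cast_add, Nat.cast_one, neg_add]
      exact h.trans (shift_displacement hy (exists_shift_neg_one hy))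
    · rw [Int.cast_add, ← add_assoc, ← hc]

lemma zIter_rankOneMap {x : 𝔖.Space} (hx : x ∈ regular 𝔖) (l : ℤ) :
    Shift l x (zIter (rankOneMap 𝔖) l x) ∧
      ∃ c : ℤ, zIter (rankOneMap 𝔖) l x = x + (c : 𝔖.Space) := by
  rw [zIter]
  split_ifs with h
  · simpa only [Int.toNat_of_nonneg h] using iterate_rankOneMap hx l.toNat
  · have := iterate_rankOneMap_symm hx (-l).toNat
    rwa [Int.toNat_of_nonneg (by omega), neg_neg] at this

lemma zIter_rankOneMap_eq_iff {x y : 𝔖.Space} (hx : x ∈ regular 𝔖) {l : ℤ} :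
    zIter (rankOneMap 𝔖) l x = y ↔ Shift l x y :=
  ⟨fun h => h ▸ (zIter_rankOneMap hx l).1, fun h => (zIter_rankOneMap hx l).1.unique_right h⟩

lemma exists_shift {x : 𝔖.Space} (hx : x ∈ regular 𝔖) (l : ℤ) :
    ∃ c : ℤ, Shift l x (x + (c : 𝔖.Space)) := by
  obtain ⟨h, c, hc⟩ := zIter_rankOneMap hx l
  exact ⟨c, hc ▸ h⟩

variable (𝔖) in
/-- The transformation of the odometer associated with a scheme. -/
noncomputable def odometerMap : 𝔖.Space ≃ᵐ 𝔖.Space := MeasurableEquiv.addRight 1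

lemma odometerMap_apply (x : 𝔖.Space) : odometerMap 𝔖 x = x + 1 := rfl

lemma odometerMap_symm_apply (x : 𝔖.Space) : (odometerMap 𝔖).symm x = x + -1 := rfl

lemma iterate_odometerMap (k : ℕ) (x : 𝔖.Space) : (odometerMap 𝔖)^[k] x = x + k := by
  induction k with
  | zero => simp
  | succ k ih => rw [Function.iterate_succ_apply', ih, odometerMap_apply, Nat.cast_succ, add_assoc]

lemma iterate_odometerMap_symm (k : ℕ) (x : 𝔖.Space) : (odometerMap 𝔖).symm^[k] x = x + -k := by
  induction k with
  | zero => simp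
  | succ k ih =>
    rw [Function.iterate_succ_apply', ih, odometerMap_symm_apply, Nat.cast_succ, add_assoc,
      neg_add]

lemma zIter_odometerMap (l : ℤ) (x : 𝔖.Space) : zIter (odometerMap 𝔖) l x = x + (l : 𝔖.Space) := by
  rw [zIter]
  split_ifs with h
  · rw [iterate_odometerMap, ← Int.cast_natCast, Int.toNat_of_nonneg h]
  · rw [iterate_odometerMap_symm, ← Int.cast_natCast, Int.toNat_of_nonneg (by omega), Int.cast_neg,
      neg_neg]

lemma orbit_rankOneMap {x : 𝔖.Space} (hx : x ∈ regular 𝔖) :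
    orbit (rankOneMap 𝔖) x = orbit (odometerMap 𝔖) x := by
  ext y
  simp only [orbit, mem_range, zIter_odometerMap, zIter_rankOneMap_eq_iff hx]
  constructor
  · rintro ⟨l, hl⟩
    obtain ⟨c, hc⟩ := exists_shift hx l
    exact ⟨c, hc.unique_right hl⟩
  · rintro ⟨c, rfl⟩
    exact exists_shift_add_intCast hx c

/-- The cocycle which expresses the odometer in terms of the rank-one dynamics. -/
noncomputable def odometerCocycle (x : 𝔖.Space) : ℤ :=
  someInt fun l => x ∈ regular 𝔖 ∧ Shift l x (x + 1)

lemma shift_odometerCocycle {x : 𝔖.Space} (hx : x ∈ regular 𝔖) :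
    Shift (odometerCocycle x) x (x + 1) := by
  obtain ⟨l, hl⟩ := exists_shift_add_one hx
  exact (someInt_spec (R := fun l => x ∈ regular 𝔖 ∧ Shift l x (x + 1)) ⟨l, hx, hl⟩).2

lemma measurable_odometerCocycle : Measurable (odometerCocycle : 𝔖.Space → ℤ) :=
  measurable_someInt
    (fun _ => measurableSet_regular.inter
      (measurableSet_shift measurable_id (measurable_add_const _) measurable_const))
    fun _ _ _ h h' => h.2.unique h'.2

end Scheme

open Classical in
lemma card_filter_not_exists_eq_add_le {H h : ℕ} {f g : ℕ → ℕ}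
    (hf : ∀ s < H, ∀ t < H, f s = f t → s = t) (hg : ∀ s < H, ∀ t < H, g s = g t → s = t)
    (hfh : ∀ s < H, f s ≤ h) (hgh : ∀ s < H, g s ≤ h) :
    ((Finset.range H).filter fun s => ¬ ∃ t < H, g t = f s).card + H ≤ h + 1 := by
  set A := (Finset.range H).filter fun s => ¬ ∃ t < H, g t = f s
  have h1 : (A.image f).card = A.card := Finset.card_image_of_injOn fun s hs t ht hst => by
    simp only [A, Finset.coe_filter, Finset.mem_range] at hs ht
    exact hf s hs.1 t ht.1 hst
  have h2 : ((Finset.range H).image g).card = H := by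
    rw [Finset.card_image_of_injOn, Finset.card_range]
    intro s hs t ht hst
    simp only [Finset.coe_range, mem_Iio] at hs ht
    exact hg s hs t ht hst
  have h3 : Disjoint (A.image f) ((Finset.range H).image g) := by
    rw [Finset.disjoint_left]
    intro y hy hy'
    simp only [A, Finset.mem_image, Finset.mem_filter, Finset.mem_range] at hy hy'
    obtain ⟨s, ⟨hs, hs'⟩, rfl⟩ := hy
    exact hs' hy'
  have h4 : A.image f ∪ (Finset.range H).image g ⊆ Finset.range (h + 1) := by
    intro y hy
    simp only [A, Finset.mem_union, Finset.mem_image, Finset.mem_filter, Finset.mem_range] at hy ⊢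
    rcases hy with ⟨s, ⟨hs, -⟩, rfl⟩ | ⟨s, hs, rfl⟩
    · exact Nat.lt_succ_of_le (hfh s hs)
    · exact Nat.lt_succ_of_le (hgh s hs)
  have h5 := Finset.card_le_card h4
  rwa [Finset.card_union_of_disjoint h3, h1, h2, Finset.card_range] at h5

open Classical in
lemma card_filter_not_exists_block_add_le {H q Q : ℕ} {b : ℕ → ℕ} (hb : ∀ i < q, b i < Q)
    (hinj : ∀ i < q, ∀ k < q, b i = b k → i = k) :
    ((Finset.range (Q * H)).filter fun s => ¬ ∃ i < q, s = b i * H + s % H).card + q * H ≤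
      Q * H := by
  set A := (Finset.range (Q * H)).filter fun s => ¬ ∃ i < q, s = b i * H + s % H
  have h1 : ((Finset.range q ×ˢ Finset.range H).image fun z => b z.1 * H + z.2).card = q * H := by
    rw [Finset.card_image_of_injOn, Finset.card_product, Finset.card_range, Finset.card_range]
    rintro ⟨i, s⟩ hs ⟨k, t⟩ ht hst
    simp only [Finset.coe_product, Finset.coe_range, mem_prod, mem_Iio] at hs ht hst
    have h2 : b i * H + s = b k * H + t := hst
    have hpos : 0 < H := by omega
    have h3 : s = t := by
      have := congrArg (· % H) h2
      simpa [Nat.mod_eq_of_lt hs.2, Nat.mod_eq_of_lt ht.2] using this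
    have h4 : b i = b k := Nat.eq_of_mul_eq_mul_right hpos (by omega)
    rw [h3, hinj i hs.1 k ht.1 h4]
  have h2 : Disjoint A ((Finset.range q ×ˢ Finset.range H).image fun z => b z.1 * H + z.2) := by
    rw [Finset.disjoint_left]
    intro y hy hy'
    simp only [Finset.mem_image, Finset.mem_product, Finset.mem_range, Prod.exists] at hy'
    obtain ⟨i, s, ⟨hi, hs⟩, rfl⟩ := hy'
    refine (Finset.mem_filter.1 hy).2 ⟨i, hi, ?_⟩
    simp [Nat.mod_eq_of_lt hs]
  have h3 : A ∪ (Finset.range q ×ˢ Finset.range H).image (fun z => b z.1 * H + z.2) ⊆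
      Finset.range (Q * H) := by
    refine Finset.union_subset (Finset.filter_subset _ _) fun y hy => ?_
    simp only [Finset.mem_image, Finset.mem_product, Finset.mem_range, Prod.exists] at hy ⊢
    obtain ⟨i, s, ⟨hi, hs⟩, rfl⟩ := hy
    have := Nat.mul_le_mul_right H (hb i hi)
    rw [Nat.succ_mul] at this
    omega
  have h4 := Finset.card_le_card h3
  rwa [Finset.card_union_of_disjoint h2, h1, Finset.card_range] at h4

namespace Scheme

variable {𝔖 : Scheme} {μ : Measure 𝔖.Space} [IsProbabilityMeasure μ]

lemma measureReal_not_isOld_le (hμ : ∀ c : 𝔖.Space, MeasurePreserving (· + c) μ μ) {n : ℕ}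
    (hn : 2 ≤ n) : μ.real {x | ¬ IsOld n x} ≤ 𝔖.w n := by
  classical
  have h1 : {x : 𝔖.Space | ¬ IsOld n x} = {x | ¬ ∃ i < (𝔖.p n).q, address (n + 1) x =
      𝔖.b n i * partialProd 𝔖.Q n + address (n + 1) x % partialProd 𝔖.Q n} := by
    simp_rw [address_succ_mod 𝔖.two_le_Q]
    rfl
  have h2 := card_filter_not_exists_block_add_le (H := partialProd 𝔖.Q n)
    (𝔖.b_lt n (by omega)) (𝔖.b_inj n (by omega))
  have hQ : (0 : ℝ) < 𝔖.Q n := by have := 𝔖.two_le_Q n; exact_mod_cast (by omega : 0 < 𝔖.Q n)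
  have hH : (0 : ℝ) < partialProd 𝔖.Q n := by exact_mod_cast partialProd_pos 𝔖.two_le_Q n
  rw [h1]
  refine ((measureReal_address_le 𝔖.two_le_Q hμ (n + 1) fun s => ¬ ∃ i < (𝔖.p n).q, s =
      𝔖.b n i * partialProd 𝔖.Q n + s % partialProd 𝔖.Q n).trans ?_).trans (𝔖.new_le n hn)
  rw [partialProd_succ]
  rw [Nat.cast_mul, div_le_div_iff₀ (by positivity) hQ]
  have h3 := (Nat.cast_le (α := ℝ)).2 h2
  push_cast at h3
  nlinarith

lemma measureReal_not_exists_eq_le (hμ : ∀ c : 𝔖.Space, MeasurePreserving (· + c) μ μ) {n : ℕ}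
    (hn : 2 ≤ n) {f g : ℕ → ℕ}
    (hf : ∀ s < partialProd 𝔖.Q n, ∀ t < partialProd 𝔖.Q n, f s = f t → s = t)
    (hg : ∀ s < partialProd 𝔖.Q n, ∀ t < partialProd 𝔖.Q n, g s = g t → s = t)
    (hfh : ∀ s < partialProd 𝔖.Q n, f s ≤ heights 𝔖.p n)
    (hgh : ∀ s < partialProd 𝔖.Q n, g s ≤ heights 𝔖.p n) :
    μ.real {x | ¬ ∃ t < partialProd 𝔖.Q n, g t = f (address n x)} ≤ 𝔖.w n := by
  classical
  refine ((measureReal_address_le 𝔖.two_le_Q hμ n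
    fun s => ¬ ∃ t < partialProd 𝔖.Q n, g t = f s).trans ?_).trans (𝔖.unused_le n hn)
  gcongr
  have := (Nat.cast_le (α := ℝ)).2 (card_filter_not_exists_eq_add_le hf hg hfh hgh)
  push_cast at this
  linarith

lemma measureReal_address_succ_eq_le (hμ : ∀ c : 𝔖.Space, MeasurePreserving (· + c) μ μ) {n : ℕ}
    (hn : 2 ≤ n) : μ.real {x | ¬ address n x + 1 < partialProd 𝔖.Q n} ≤ 𝔖.w n := by
  have hpos := partialProd_pos 𝔖.two_le_Q n
  have h1 : {x : 𝔖.Space | ¬ address n x + 1 < partialProd 𝔖.Q n} =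
      {x | address n x = partialProd 𝔖.Q n - 1} := by
    ext x
    have := address_lt 𝔖.two_le_Q n x
    simp only [mem_ofPred_eq]
    omega
  have h2 := card_filter_not_exists_eq_add_le (𝔖.a_inj n (by omega)) (𝔖.a_inj n (by omega))
    (fun s hs => (𝔖.a_lt n (by omega) s hs).le.trans le_rfl)
    (fun s hs => (𝔖.a_lt n (by omega) s hs).le)
  have h3 : partialProd 𝔖.Q n ≤ heights 𝔖.p n := by
    have := Finset.card_le_card_of_injOn (s := Finset.range (partialProd 𝔖.Q n))
      (t := Finset.range (heights 𝔖.p n)) (𝔖.a n)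
      (fun j hj => by
        simp only [Finset.coe_range, mem_Iio] at hj ⊢
        exact 𝔖.a_lt n (by omega) j hj)
      (fun j hj k hk hjk => by
        simp only [Finset.coe_range, mem_Iio] at hj hk
        exact 𝔖.a_inj n (by omega) j hj k hk hjk)
    simpa using this
  rw [h1, measureReal_address_eq 𝔖.two_le_Q hμ n (by omega)]
  refine le_trans ?_ (𝔖.unused_le n hn)
  gcongr
  have := (Nat.cast_le (α := ℝ)).2 h3
  linarith

lemma measureReal_not_isGood_le (hμ : ∀ c : 𝔖.Space, MeasurePreserving (· + c) μ μ) {n : ℕ}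
    (hn : 2 ≤ n) : μ.real {x | ¬ IsGood n x} ≤ 4 * 𝔖.w n := by
  have h0 : 1 ≤ n := by omega
  have h1 := measureReal_not_isOld_le hμ hn
  have h2 := measureReal_not_exists_eq_le hμ hn (f := fun s => 𝔖.a n s + 1) (g := 𝔖.a n)
    (fun s hs t ht hst => 𝔖.a_inj n h0 s hs t ht (Nat.succ_injective hst)) (𝔖.a_inj n h0)
    (𝔖.a_lt n h0) fun s hs => (𝔖.a_lt n h0 s hs).le
  have h3 := measureReal_not_exists_eq_le hμ hn (f := 𝔖.a n) (g := fun s => 𝔖.a n s + 1)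
    (𝔖.a_inj n h0) (fun s hs t ht hst => 𝔖.a_inj n h0 s hs t ht (Nat.succ_injective hst))
    (fun s hs => (𝔖.a_lt n h0 s hs).le) (𝔖.a_lt n h0)
  have h4 := measureReal_address_succ_eq_le hμ hn
  have h5 : {x : 𝔖.Space | ¬ IsGood n x} ⊆ {x | ¬ IsOld n x} ∪
      {x | ¬ ∃ t < partialProd 𝔖.Q n, 𝔖.a n t = 𝔖.a n (address n x) + 1} ∪
      {x | ¬ ∃ t < partialProd 𝔖.Q n, 𝔖.a n t + 1 = 𝔖.a n (address n x)} ∪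
      {x | ¬ address n x + 1 < partialProd 𝔖.Q n} := by
    intro x hx
    by_contra h
    simp only [mem_union, mem_ofPred_eq, not_or, not_not] at h
    exact hx ⟨h.1.1.1, h.1.1.2, h.1.2, h.2⟩
  refine (measureReal_mono h5 (measure_ne_top _ _)).trans ?_
  refine (measureReal_union_le _ _).trans ?_
  have h6 := measureReal_union_le (μ := μ) ({x | ¬ IsOld n x} ∪
      {x | ¬ ∃ t < partialProd 𝔖.Q n, 𝔖.a n t = 𝔖.a n (address n x) + 1})
      {x | ¬ ∃ t < partialProd 𝔖.Q n, 𝔖.a n t + 1 = 𝔖.a n (address n x)}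
  have h7 := measureReal_union_le (μ := μ) {x | ¬ IsOld n x}
      {x | ¬ ∃ t < partialProd 𝔖.Q n, 𝔖.a n t = 𝔖.a n (address n x) + 1}
  linarith

lemma ae_eventually_isGood (hμ : ∀ c : 𝔖.Space, MeasurePreserving (· + c) μ μ) :
    ∀ᵐ x ∂μ, ∀ᶠ n in atTop, IsGood n x := by
  have h1 : ∑' n, μ {x | ¬ IsGood (n + 2) x} ≠ ⊤ := by
    have hsum : Summable fun n => 4 * 𝔖.w (n + 2) :=
      ((summable_nat_add_iff 2).2 𝔖.summable_w).mul_left 4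
    refine ((ENNReal.tsum_le_tsum fun n => ?_).trans_lt hsum.tsum_ofReal_lt_top).ne
    rw [← ofReal_measureReal]
    exact ENNReal.ofReal_le_ofReal (measureReal_not_isGood_le hμ (by omega))
  filter_upwards [ae_eventually_notMem h1] with x hx
  obtain ⟨N, hN⟩ := eventually_atTop.1 hx
  filter_upwards [eventually_ge_atTop (N + 2)] with n hn
  have := hN (n - 2) (by omega)
  rw [show n - 2 + 2 = n by omega] at this
  simpa using this

lemma ae_mem_regular (hμ : ∀ c : 𝔖.Space, MeasurePreserving (· + c) μ μ) :
    ∀ᵐ x ∂μ, x ∈ regular 𝔖 :=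
  ae_all_iff.2 fun j => (hμ (j : 𝔖.Space)).quasiMeasurePreserving.ae (ae_eventually_isGood hμ)

end Scheme

namespace Scheme

variable {𝔖 : Scheme}

/-- The level at height `k` of the `n`-th tower of the rank-one dynamics. -/
def towerLevel (n : ℕ) (k : ℤ) : Set 𝔖.Space :=
  {x | x ∈ regular 𝔖 ∧ ∃ c : ℤ, IsOldFrom n (x + (c : 𝔖.Space)) ∧
    Shift (k - level n (x + (c : 𝔖.Space))) (x + (c : 𝔖.Space)) x}

lemma measurableSet_towerLevel (n : ℕ) (k : ℤ) :
    MeasurableSet (towerLevel n k : Set 𝔖.Space) := by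
  have : (towerLevel n k : Set 𝔖.Space) = regular 𝔖 ∩ ⋃ c : ℤ,
      ((· + (c : 𝔖.Space)) ⁻¹' {x | IsOldFrom n x} ∩
        {x | Shift (k - level n (x + (c : 𝔖.Space))) (x + (c : 𝔖.Space)) x}) := by
    ext x
    simp [towerLevel]
  rw [this]
  refine measurableSet_regular.inter (.iUnion fun c => ?_)
  have hc : Measurable fun x : 𝔖.Space => x + (c : 𝔖.Space) := measurable_add_const _
  exact (hc (measurableSet_isOldFrom n)).inter (measurableSet_shift hc measurable_id
    (measurable_const.sub (measurable_from_top.comp ((measurable_level n).comp hc))))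

lemma add_mem_towerLevel {n : ℕ} {k l : ℤ} {x : 𝔖.Space} (hx : x ∈ towerLevel n k) {c : ℤ}
    (h : Shift l x (x + (c : 𝔖.Space))) : x + (c : 𝔖.Space) ∈ towerLevel n (k + l) := by
  obtain ⟨hreg, d, hd, hs⟩ := hx
  refine ⟨add_intCast_mem_regular hreg c, d - c, ?_⟩
  have : x + (c : 𝔖.Space) + ((d - c : ℤ) : 𝔖.Space) = x + (d : 𝔖.Space) := by
    push_cast
    ring
  rw [this]
  refine ⟨hd, ?_⟩
  rw [add_sub_right_comm]
  exact hs.trans h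

lemma image_towerLevel (n : ℕ) (k : ℤ) (l : ℕ) :
    (rankOneMap 𝔖)^[l] '' towerLevel n k = towerLevel n (k + l) := by
  ext y
  constructor
  · rintro ⟨x, hx, rfl⟩
    obtain ⟨h, c, hc⟩ := iterate_rankOneMap hx.1 l
    rw [hc] at h ⊢
    exact add_mem_towerLevel hx h
  · intro hy
    obtain ⟨h, c, hc⟩ := iterate_rankOneMap_symm hy.1 l
    refine ⟨(rankOneMap 𝔖).symm^[l] y, ?_, (rankOneMap 𝔖).right_inv.iterate l y⟩
    rw [hc] at h ⊢
    simpa using add_mem_towerLevel hy h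

lemma exists_level_eq_add {n : ℕ} (hn : 1 ≤ n) {x y : 𝔖.Space} (hx : IsOldFrom n x)
    (hy : IsOldFrom n y) {m : ℕ} (hm : n ≤ m) :
    ∃ u v : ℕ, level m x = level n x + u ∧ level m y = level n y + v ∧
      u + heights 𝔖.p n ≤ heights 𝔖.p m ∧ v + heights 𝔖.p n ≤ heights 𝔖.p m ∧
      ∀ k < heights 𝔖.p n, ∀ l < heights 𝔖.p n, u + k = v + l → k = l := by
  induction m, hm using Nat.le_induction with
  | base => exact ⟨0, 0, rfl, rfl, by omega, by omega, fun k _ l _ h => by omega⟩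
  | succ m hm ih =>
    obtain ⟨u, v, hu, hv, hum, hvm, huv⟩ := ih
    obtain ⟨i, hi, hxi⟩ := hx m hm
    obtain ⟨j, hj, hyj⟩ := hy m hm
    have h1 : level (m + 1) x = colStart 𝔖.p m i + level m x := by
      rw [level, hxi, 𝔖.a_succ m (hn.trans hm) i hi _ (address_lt 𝔖.two_le_Q _ _), level]
    have h2 : level (m + 1) y = colStart 𝔖.p m j + level m y := by
      rw [level, hyj, 𝔖.a_succ m (hn.trans hm) j hj _ (address_lt 𝔖.two_le_Q _ _), level]
    have h3 := colStart_add_le_heights 𝔖.p m hi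
    have h4 := colStart_add_le_heights 𝔖.p m hj
    refine ⟨colStart 𝔖.p m i + u, colStart 𝔖.p m j + v, by omega, by omega, by omega, by omega,
      fun k hk l hl hkl => huv k hk l hl ?_⟩
    rw [add_assoc, add_assoc] at hkl
    exact (start_decomposition (colStart_add_le 𝔖.p m) (by omega) (by omega) hkl).2

lemma disjoint_towerLevel {n : ℕ} (hn : 1 ≤ n) {k l : ℕ} (hk : k < heights 𝔖.p n)
    (hl : l < heights 𝔖.p n) (hkl : k ≠ l) :
    Disjoint (towerLevel n k : Set 𝔖.Space) (towerLevel n l) := by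
  rw [Set.disjoint_left]
  rintro x ⟨-, c, hc, hcs⟩ ⟨-, d, hd, hds⟩
  obtain ⟨m, ⟨h1, h2⟩, h3⟩ := ((hcs.and hds).and (eventually_ge_atTop n)).exists
  obtain ⟨u, v, hu, hv, -, -, huv⟩ := exists_level_eq_add hn hc hd h3
  exact hkl (huv k hk l hl (by omega))

lemma towerLevel_eq_iUnion {n : ℕ} (hn : 1 ≤ n) (k : ℤ) :
    (towerLevel n k : Set 𝔖.Space) =
      ⋃ i ∈ Finset.range (𝔖.p n).q, towerLevel (n + 1) (colStart 𝔖.p n i + k) := by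
  ext x
  simp only [mem_iUnion, Finset.mem_range, exists_prop]
  constructor
  · rintro ⟨hx, c, hc, hs⟩
    obtain ⟨i, hi, hci⟩ := hc n le_rfl
    refine ⟨i, hi, hx, c, fun m hm => hc m (by omega), ?_⟩
    rw [level, hci, 𝔖.a_succ n hn i hi _ (address_lt 𝔖.two_le_Q _ _), Nat.cast_add,
      add_sub_add_left_eq_sub]
    exact hs
  · rintro ⟨i, hi, hx, c, hc, hs⟩
    have hpos := partialProd_pos 𝔖.two_le_Q n
    have ht : 𝔖.b n i * partialProd 𝔖.Q n < partialProd 𝔖.Q (n + 1) := by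
      rw [partialProd_succ]
      exact Nat.mul_lt_mul_of_pos_right (𝔖.b_lt n hn i hi) hpos
    obtain ⟨h1, h2, h3⟩ := IsOldFrom.address_add (by omega) hc ht rfl
    set d : ℤ := (𝔖.b n i * partialProd 𝔖.Q n : ℕ) - address (n + 1) (x + (c : 𝔖.Space))
    have h4 : address n (x + (c : 𝔖.Space) + (d : 𝔖.Space)) = 0 := by
      rw [← address_succ_mod 𝔖.two_le_Q, h1, Nat.mul_mod_left]
    refine ⟨hx, c + d, ?_⟩
    rw [Int.cast_add, ← add_assoc]
    refine ⟨fun m hm => ?_, ?_⟩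
    · rcases hm.eq_or_lt with rfl | hm
      · exact ⟨i, hi, by rw [h1, h4, add_zero]⟩
      · exact h2 m hm
    · have h5 := 𝔖.a_succ n hn i hi 0 hpos
      rw [add_zero] at h5
      have h6 := h3.symm.trans hs
      rw [level, h4]
      rw [h5, Nat.cast_add] at h6
      convert h6 using 1
      ring

lemma towerLevel_eq_address {m : ℕ} (hm : 1 ≤ m) {j : ℕ} (hj : j < partialProd 𝔖.Q m) :
    (towerLevel m (𝔖.a m j) : Set 𝔖.Space) =
      {x | x ∈ regular 𝔖 ∧ IsOldFrom m x ∧ address m x = j} := by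
  ext x
  constructor
  · rintro ⟨hx, c, hc, hs⟩
    obtain ⟨h1, h2, h3⟩ := hc.address_add hm hj rfl
    rw [← hs.unique_right h3] at h1 h2
    exact ⟨hx, h2, h1⟩
  · rintro ⟨hx, h1, rfl⟩
    refine ⟨hx, 0, ?_⟩
    rw [Int.cast_zero, add_zero, level, sub_self]
    exact ⟨h1, shift_refl x⟩

variable (𝔖) in
/-- The part of the base of the `n`-th tower below the `i`-th subcolumn. -/
def subBase (n i : ℕ) : Set 𝔖.Space := towerLevel (n + 1) (colStart 𝔖.p n i)

variable (𝔖) in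
/-- The base of the `n`-th tower. -/
def base (n : ℕ) : Set 𝔖.Space := ⋃ i ∈ Finset.range (𝔖.p n).q, subBase 𝔖 n i

lemma base_eq_towerLevel {n : ℕ} (hn : 1 ≤ n) : base 𝔖 n = towerLevel n 0 := by
  rw [towerLevel_eq_iUnion hn]
  simp [base, subBase]

lemma image_base {n : ℕ} (hn : 1 ≤ n) (k : ℕ) :
    (rankOneMap 𝔖)^[k] '' base 𝔖 n = towerLevel n k := by
  rw [base_eq_towerLevel hn, image_towerLevel, zero_add]

lemma image_subBase (n i k : ℕ) :
    (rankOneMap 𝔖)^[k] '' subBase 𝔖 n i = towerLevel (n + 1) (colStart 𝔖.p n i + k : ℕ) := by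
  rw [subBase, image_towerLevel, Nat.cast_add]

lemma measurableSet_subBase (n i : ℕ) : MeasurableSet (subBase 𝔖 n i) :=
  measurableSet_towerLevel _ _

variable (𝔖) in
lemma isCuttingStacking_rankOneMap :
    IsCuttingStacking (rankOneMap 𝔖) 𝔖.p (base 𝔖) (subBase 𝔖) where
  meas_base n := .biUnion (Finset.countable_toSet _) fun i _ => measurableSet_subBase n i
  meas_sub n i _ := measurableSet_subBase n i
  disj_levels n k hk l hl hkl := by
    rcases n with _ | n
    · simp only [heights] at hk hl
      omega
    · rw [image_base (by omega), image_base (by omega)]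
      exact disjoint_towerLevel (by omega) hk hl hkl
  disj_sub n i hi j hj hij := by
    have h1 := colStart_add_le_heights 𝔖.p n hi
    have h2 := colStart_add_le_heights 𝔖.p n hj
    have h3 := heights_pos 𝔖.p n
    exact disjoint_towerLevel (by omega) (by omega) (by omega) fun h =>
      hij (start_decomposition (x := 0) (y := 0) (colStart_add_le 𝔖.p n) h3 h3 h).1
  union_sub n := rfl
  subcolumn n i _ k _ := by rw [image_base (by omega), image_subBase]
  spacer_disjoint n l hl h := by
    rw [image_base (by omega), towerUnion]
    simp only [base, image_iUnion, image_subBase, disjoint_iUnion_right, Finset.mem_range]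
    intro k hk i hi
    have := colStart_add_le_heights 𝔖.p n hi
    exact disjoint_towerLevel (by omega) hl (by omega) (h i hi k hk)

lemma eventually_isOldFrom {x : 𝔖.Space} (hx : x ∈ regular 𝔖) (N : ℕ) :
    ∃ n, N ≤ n ∧ IsOldFrom n x :=
  have ⟨n, _, hn, h⟩ := exists_isOldFrom hx N
  ⟨n, hn, fun m hm => (h m hm).isOld⟩

lemma address_eq_iff_mem_towerLevel {x : 𝔖.Space} (hx : x ∈ regular 𝔖) {n : ℕ} (hn : 1 ≤ n)
    (j : ℕ) : address n x = j ↔ ∃ m, n ≤ m ∧ ∃ k < partialProd 𝔖.Q m,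
      k % partialProd 𝔖.Q n = j ∧ x ∈ (towerLevel m (𝔖.a m k) : Set 𝔖.Space) := by
  constructor
  · rintro rfl
    obtain ⟨m, hm, h⟩ := eventually_isOldFrom hx n
    have hlt := address_lt 𝔖.two_le_Q m x
    refine ⟨m, hm, address m x, hlt, address_mod 𝔖.two_le_Q hm x, ?_⟩
    rw [towerLevel_eq_address (hn.trans hm) hlt]
    exact ⟨hx, h, rfl⟩
  · rintro ⟨m, hm, k, hk, rfl, h⟩
    rw [towerLevel_eq_address (hn.trans hm) hk] at h
    rw [← h.2.2, address_mod 𝔖.two_le_Q hm]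

lemma towersGenerate_rankOneMap {μ : Measure 𝔖.Space} (hμ : ∀ᵐ x ∂μ, x ∈ regular 𝔖) :
    TowersGenerate μ (rankOneMap 𝔖) 𝔖.p (base 𝔖) := by
  intro A hA
  set G := MeasurableSpace.generateFrom
    {s : Set 𝔖.Space | ∃ n k, k < heights 𝔖.p n ∧ s = (rankOneMap 𝔖)^[k] '' base 𝔖 n}
  have hG : ∀ n, 1 ≤ n → ∀ k < partialProd 𝔖.Q n,
      MeasurableSet[G] (towerLevel n (𝔖.a n k) : Set 𝔖.Space) := fun n hn k hk =>
    MeasurableSpace.measurableSet_generateFrom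
      ⟨n, 𝔖.a n k, 𝔖.a_lt n hn k hk, (image_base hn _).symm⟩
  have hval : @Measurable _ _ (G.comap Subtype.val) (instMeasurableSpaceOdometerSpace 𝔖.Q)
      (Subtype.val : regular 𝔖 → 𝔖.Space) := by
    refine @measurable_of_address _ 𝔖.two_le_Q _ (G.comap Subtype.val) _ 1 fun n hn j _ => ?_
    refine ⟨⋃ m, ⋃ (_ : n ≤ m), ⋃ k, ⋃ (_ : k < partialProd 𝔖.Q m),
      ⋃ (_ : k % partialProd 𝔖.Q n = j), towerLevel m (𝔖.a m k), ?_, ?_⟩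
    · exact .iUnion fun m => .iUnion fun hm => .iUnion fun k => .iUnion fun hk => .iUnion fun _ =>
        hG m (hn.trans hm) k hk
    · ext x
      simp only [mem_preimage, mem_iUnion, exists_prop, mem_ofPred_eq,
        address_eq_iff_mem_towerLevel x.2 hn]
  obtain ⟨A', hA', hAA'⟩ := hval hA
  refine ⟨A', hA', ?_⟩
  refine measure_mono_null (t := {x | x ∉ regular 𝔖}) (fun x hx hxr => ?_) (ae_iff.1 hμ)
  have h : x ∈ A' ↔ x ∈ A := Set.ext_iff.1 hAA' ⟨x, hxr⟩
  rcases hx with hx | hx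
  · exact hx.2 (h.2 hx.1)
  · exact hx.2 (h.1 hx.1)

variable {μ : Measure 𝔖.Space} [IsProbabilityMeasure μ]

lemma isRankOneWith_rankOneMap (hμ : ∀ c : 𝔖.Space, MeasurePreserving (· + c) μ μ)
    (hF : CondF 𝔖.p) : IsRankOneWith μ (rankOneMap 𝔖) 𝔖.p :=
  ⟨measurePreserving_of_eq_add hμ _ (measurable_displacement 1) fun _ => rfl, hF, _, _,
    isCuttingStacking_rankOneMap 𝔖, towersGenerate_rankOneMap (ae_mem_regular hμ)⟩

end Scheme

namespace Scheme

variable {𝔖 : Scheme}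

variable (𝔖) in
/-- The cutting and spacing parameters of the odometer. -/
def odometerParam (n : ℕ) : CSParam := ⟨𝔖.Q n, 𝔖.two_le_Q n, fun _ => 0, fun _ _ => rfl⟩

lemma heights_odometerParam (n : ℕ) : heights (odometerParam 𝔖) n = partialProd 𝔖.Q n := by
  induction n with
  | zero => rfl
  | succ n ih => simp [heights, ih, partialProd_succ, odometerParam, CSParam.σtot]

lemma colStart_odometerParam (n i : ℕ) :
    colStart (odometerParam 𝔖) n i = i * partialProd 𝔖.Q n := by
  rw [colStart, heights_odometerParam]
  simp [odometerParam]

lemma image_odometerMap {n j k : ℕ} (h : j + k < partialProd 𝔖.Q n) :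
    (odometerMap 𝔖)^[k] '' {x | address n x = j} = {x | address n x = j + k} := by
  ext y
  constructor
  · rintro ⟨x, rfl, rfl⟩
    have := address_add_natCast 𝔖.two_le_Q n x (c := k) (by omega) (by omega)
    rw [Int.cast_natCast] at this
    rw [mem_ofPred_eq, iterate_odometerMap]
    omega
  · intro hy
    rw [mem_ofPred_eq] at hy
    have := address_add_natCast 𝔖.two_le_Q n y (c := -k) (by omega) (by omega)
    rw [Int.cast_neg, Int.cast_natCast] at this
    refine ⟨y + -(k : 𝔖.Space), ?_, ?_⟩
    · rw [mem_ofPred_eq]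
      omega
    · rw [iterate_odometerMap, neg_add_cancel_right]

lemma disjoint_address {n i j : ℕ} (h : i ≠ j) :
    Disjoint {x : 𝔖.Space | address n x = i} {x | address n x = j} :=
  Set.disjoint_left.2 fun _ hi hj => h (hi.symm.trans hj)

lemma measurableSet_address (n j : ℕ) : MeasurableSet {x : 𝔖.Space | address n x = j} :=
  measurable_address n (measurableSet_singleton j)

lemma image_odometerMap_base {n k : ℕ} (h : k < partialProd 𝔖.Q n) :
    (odometerMap 𝔖)^[k] '' {x | address n x = 0} = {x | address n x = k} := by
  simpa using image_odometerMap (j := 0) (by omega : 0 + k < partialProd 𝔖.Q n)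

lemma block_lt {n i k : ℕ} (hi : i < 𝔖.Q n) (hk : k < partialProd 𝔖.Q n) :
    i * partialProd 𝔖.Q n + k < partialProd 𝔖.Q (n + 1) := by
  have := Nat.mul_le_mul_right (partialProd 𝔖.Q n) (Nat.succ_le_of_lt hi)
  rw [Nat.succ_mul] at this
  rw [partialProd_succ]
  omega

variable (𝔖) in
lemma isCuttingStacking_odometerMap :
    IsCuttingStacking (odometerMap 𝔖) (odometerParam 𝔖) (fun n => {x | address n x = 0})
      (fun n i => {x | address (n + 1) x = i * partialProd 𝔖.Q n}) where
  meas_base n := measurableSet_address n 0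
  meas_sub n i _ := measurableSet_address _ _
  disj_levels n k hk l hl hkl := by
    rw [heights_odometerParam] at hk hl
    rw [image_odometerMap_base hk, image_odometerMap_base hl]
    exact disjoint_address hkl
  disj_sub n i _ j _ hij := disjoint_address fun h =>
    hij (Nat.eq_of_mul_eq_mul_right (partialProd_pos 𝔖.two_le_Q n) h)
  union_sub n := by
    ext x
    simp only [mem_ofPred_eq, mem_iUnion, Finset.mem_range, exists_prop]
    rw [← address_succ_mod 𝔖.two_le_Q n x]
    constructor
    · intro h
      obtain ⟨i, hi⟩ := Nat.dvd_of_mod_eq_zero h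
      refine ⟨i, ?_, by rw [hi, mul_comm]⟩
      have := address_lt 𝔖.two_le_Q (n + 1) x
      rw [partialProd_succ, hi, mul_comm] at this
      exact Nat.lt_of_mul_lt_mul_right this
    · rintro ⟨i, -, hi⟩
      rw [hi, Nat.mul_mod_left]
  subcolumn n i hi k hk := by
    rw [heights_odometerParam] at hk
    rw [colStart_odometerParam, image_odometerMap_base (block_lt hi hk),
      image_odometerMap (block_lt hi hk)]
  spacer_disjoint n l hl h := by
    rw [heights_odometerParam, partialProd_succ] at hl
    simp only [colStart_odometerParam, heights_odometerParam] at h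
    exact absurd (Nat.div_add_mod' l _).symm (h _ (Nat.div_lt_of_lt_mul (mul_comm (𝔖.Q n) _ ▸ hl)) _
      (Nat.mod_lt _ (partialProd_pos 𝔖.two_le_Q n)))

lemma towersGenerate_odometerMap (μ : Measure 𝔖.Space) :
    TowersGenerate μ (odometerMap 𝔖) (odometerParam 𝔖) (fun n => {x | address n x = 0}) := by
  refine fun A hA => ⟨A, ?_, by simp⟩
  set G := MeasurableSpace.generateFrom {s : Set 𝔖.Space | ∃ n k,
    k < heights (odometerParam 𝔖) n ∧ s = (odometerMap 𝔖)^[k] '' {x | address n x = 0}}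
  have hid : @Measurable _ _ G (instMeasurableSpaceOdometerSpace 𝔖.Q) (id : 𝔖.Space → 𝔖.Space) :=
    @measurable_of_address _ 𝔖.two_le_Q _ G _ 0 fun n _ k hk =>
      MeasurableSpace.measurableSet_generateFrom
        ⟨n, k, by rwa [heights_odometerParam], (image_odometerMap_base hk).symm⟩
  exact hid hA

variable {μ : Measure 𝔖.Space}

lemma isUniversalOdometer_odometerMap (hμ : ∀ c : 𝔖.Space, MeasurePreserving (· + c) μ μ)
    (h : ∀ N, 0 < N → ∃ n, N ∣ partialProd 𝔖.Q n) :
    IsUniversalOdometer μ (odometerMap 𝔖) := by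
  refine ⟨odometerParam 𝔖, ⟨hμ 1, ?_, _, _, isCuttingStacking_odometerMap 𝔖,
    towersGenerate_odometerMap μ⟩, fun _ _ => rfl, h⟩
  simp [CondF, CSParam.σtot, odometerParam, summable_zero]

lemma displacement_le {x : 𝔖.Space} (hx : x ∈ regular 𝔖) {n : ℕ} (hn : 1 ≤ n)
    (h : ∀ m, n < m → IsGood m x) : |displacement 1 x| ≤ 𝔖.M n := by
  have hold : IsOldFrom (n + 1) x := fun m hm => (h m hm).isOld
  obtain ⟨t, ht, hat⟩ := (h (n + 1) n.lt_succ_self).next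
  obtain ⟨-, -, h1⟩ := hold.address_add (by omega) ht rfl
  rw [hat, Nat.cast_add, Nat.cast_one, add_sub_cancel_left] at h1
  have h2 := (shift_displacement hx ⟨_, h1⟩).unique_right h1
  rw [intCast_injective 𝔖.two_le_Q (add_left_cancel h2)]
  exact 𝔖.T_bound n hn _ (address_lt 𝔖.two_le_Q _ _) t ht hat

lemma odometerCocycle_le {x : 𝔖.Space} (hx : x ∈ regular 𝔖) {n : ℕ} (hn : 1 ≤ n)
    (h : ∀ m, n < m → IsGood m x) : |odometerCocycle x| ≤ 𝔖.M n := by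
  have hold : IsOldFrom (n + 1) x := fun m hm => (h m hm).isOld
  have hlt := (h (n + 1) n.lt_succ_self).succ_lt
  have h1 := (hold.add (by omega) (c := 1) (by omega) (by omega)).2
  have h2 := address_add_natCast 𝔖.two_le_Q (n + 1) x (c := 1) (by omega) (by omega)
  rw [Int.cast_one] at h1 h2
  have h3 : address (n + 1) (x + 1) = address (n + 1) x + 1 := by omega
  rw [(shift_odometerCocycle hx).unique h1, level, level, h3]
  exact 𝔖.S_bound n hn _ hlt

lemma phiIntegrablyOE [IsProbabilityMeasure μ]
    (hμ : ∀ c : 𝔖.Space, MeasurePreserving (· + c) μ μ) {φ : ℝ → ℝ}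
    (hφ0 : ∀ t, 0 ≤ t → 0 ≤ φ t) {Φ : ℕ → ℝ} (hΦ0 : ∀ n, 0 ≤ Φ n)
    (hΦ : ∀ n, ∀ t : ℕ, t ≤ 𝔖.M n → φ t ≤ Φ n) (hsum : Summable fun n => Φ n * 𝔖.w n) :
    PhiIntegrablyOE μ (rankOneMap 𝔖) μ (odometerMap 𝔖) φ := by
  have hreg := ae_mem_regular hμ
  have hinteg : ∀ {c : 𝔖.Space → ℤ}, Measurable c →
      (∀ x ∈ regular 𝔖, ∀ n, 1 ≤ n → (∀ m, n < m → IsGood m x) → |c x| ≤ 𝔖.M n) →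
      Integrable (fun x => φ |(c x : ℝ)|) μ := fun hc h =>
    integrable_comp_abs hφ0 hc (E := fun n => {x | ¬ IsGood n x})
      (fun n => (measurableSet_isGood n).compl) hΦ0 hΦ hsum
      (fun n hn => measureReal_not_isGood_le hμ hn)
      ((ae_eventually_isGood hμ).mono fun x hx => hx.mono fun n hn => not_not.2 hn)
      (hreg.mono fun x hx n hn hm => h x hx n hn fun m hnm => not_not.1 (hm m hnm))
  refine ⟨.refl _, .id μ, ?_, displacement 1, odometerCocycle, measurable_displacement 1,
    measurable_odometerCocycle, ?_, ?_, hinteg (measurable_displacement 1)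
      (fun x hx n => displacement_le hx), hinteg measurable_odometerCocycle
      (fun x hx n => odometerCocycle_le hx)⟩
  · filter_upwards [hreg] with x hx
    exact (image_id _).trans (orbit_rankOneMap hx)
  · exact ae_of_all _ fun x => (zIter_odometerMap _ _).symm
  · filter_upwards [hreg] with x hx
    exact ((zIter_rankOneMap_eq_iff hx).2 (shift_odometerCocycle hx)).symm

end Scheme

/-- Let `φ : [0,∞) → [0,∞)` satisfy `φ(t) = o(t^{1/3})` as `t → ∞`.
If `𝒞` is a flexible class of rank-one systems, then there exists a rank-one system `T`
belonging to `𝒞` which is `φ`-integrably orbit equivalent to the universal odometer. -/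
theorem flexible_class_contains_system_phi_OE_to_universal_odometer
    (φ : ℝ → ℝ) (hφ0 : ∀ t : ℝ, 0 ≤ t → 0 ≤ φ t) (hφ : SmallOCbrt φ)
    (𝒞 : MSystem → Prop)
    (h𝒞 : ∀ 𝒮 : MSystem, 𝒞 𝒮 → IsRankOne 𝒮.μ 𝒮.T)
    (hflex : IsFlexibleClass 𝒞) :
    ∃ 𝒮 : MSystem, 𝒮.Standard ∧ IsRankOne 𝒮.μ 𝒮.T ∧ 𝒞 𝒮 ∧
      PhiOEToUnivOdometer 𝒮.μ 𝒮.T φ := by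
  obtain ⟨F, ⟨C, -, hC⟩, h2, C', hC', h3⟩ := hflex
  obtain ⟨𝔖, hF, hmem, hdvd, Φ, hΦ0, hΦ, hsum⟩ := exists_scheme hφ hC' h2 h3
  obtain ⟨μ, hprob, hμ⟩ := exists_invariant_measure 𝔖.two_le_Q
  have hT := 𝔖.isRankOneWith_rankOneMap hμ hF
  have hstd : ∀ T : 𝔖.Space ≃ᵐ 𝔖.Space, (MSystem.mk 𝔖.Space μ T).Standard := fun T =>
    ⟨inferInstanceAs (StandardBorelSpace 𝔖.Space), hprob, noAtoms_of_invariant 𝔖.two_le_Q hμ⟩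
  exact ⟨⟨𝔖.Space, μ, 𝔖.rankOneMap⟩, hstd _, ⟨𝔖.p, hT⟩, (hC 𝔖.p hF hmem).2 _ (hstd _) hT,
    ⟨𝔖.Space, μ, 𝔖.odometerMap⟩, hstd _, 𝔖.isUniversalOdometer_odometerMap hμ hdvd,
    𝔖.phiIntegrablyOE hμ hφ0 hΦ0 hΦ hsum⟩
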